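/- arXiv:1810.10127 — 5 statements merged into one kernel-verified Lean document; each statement's English description precedes it below -/
import Mathlib

section
/- Let α = p/q + Σ_{j=2}^∞ 1/x_j. Then α is irrational and its regular continued fraction expansion α = [b_0; b_1, b_2, …] has partial quotients b_j = a_j for 0 ≤ j ≤ 2k, b_{2k+1} = m + u_1·y_0, and b_{2k+2j} = x_j, b_{2k+2j+1} = u_{j+1}·y_j for all j ≥ 1. -/
open Filter Topology

/-- The continuants of the partial quotients `b`, with initial values `s` and `t`. -/
def continuant (b : ℕ → ℤ) (s t : ℤ) : ℕ → ℤ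
  | 0 => s
  | 1 => t
  | n + 2 => b n * continuant b s t (n + 1) + continuant b s t n

theorem continuant_add_two (b : ℕ → ℤ) (s t : ℤ) (n : ℕ) :
    continuant b s t (n + 2) = b n * continuant b s t (n + 1) + continuant b s t n := rfl

theorem eq_continuant {b a c : ℕ → ℤ} {s t : ℤ} {N : ℕ} (h0 : c 0 = s) (h1 : c 1 = t)
    (hc : ∀ n, c (n + 2) = a n * c (n + 1) + c n) (hb : ∀ n < N, b n = a n) :
    ∀ n ≤ N + 1, c n = continuant b s t n := by
  intro n
  induction n using Nat.twoStepInduction with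
  | zero => intro _; exact h0
  | one => intro _; exact h1
  | more n ih ih' =>
    intro hn
    rw [hc, continuant_add_two, ih (by omega), ih' (by omega), hb n (by omega)]

theorem continuant_denom_nonneg {a c : ℕ → ℤ} {N : ℕ} (h0 : c 0 = 1) (h1 : c 1 = 0)
    (hc : ∀ n, c (n + 2) = a n * c (n + 1) + c n) (ha : ∀ n, 1 ≤ n → n < N → 1 ≤ a n) :
    ∀ n ≤ N + 1, 0 ≤ c n := by
  intro n
  induction n using Nat.twoStepInduction with
  | zero => intro _; simp [h0]
  | one => intro _; simp [h1]
  | more n ih ih' =>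
    intro hn
    rw [hc]
    rcases Nat.eq_zero_or_pos n with rfl | hpos
    · simp [h0, h1]
    · have h := ha n hpos (by omega)
      have h' := ih' (by omega)
      have h'' := ih (by omega)
      positivity

theorem continuant_det (b : ℕ → ℤ) (n : ℕ) :
    continuant b 1 0 n * continuant b 0 1 (n + 1) -
      continuant b 0 1 n * continuant b 1 0 (n + 1) = (-1) ^ n := by
  induction n with
  | zero => simp [continuant]
  | succ n ih =>
    rw [continuant_add_two, continuant_add_two, pow_succ, ← ih]
    ring

theorem continuant_cross_nonneg {b : ℕ → ℤ} (hb : ∀ n, 1 ≤ n → 1 ≤ b n) {n : ℕ} (hn : 1 ≤ n)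
    (i : ℕ) :
    0 ≤ (-1) ^ n * (continuant b 1 0 n * continuant b 0 1 (n + i) -
      continuant b 0 1 n * continuant b 1 0 (n + i)) := by
  induction i using Nat.twoStepInduction with
  | zero => simp [mul_comm]
  | one => rw [continuant_det, ← mul_pow]; simp
  | more i ih ih' =>
    have h := hb (n + i) (by omega)
    rw [← add_assoc n i 2, continuant_add_two, continuant_add_two]
    rw [← add_assoc n i 1] at ih'
    nlinarith [mul_nonneg (zero_le_one.trans h) ih']

theorem intFractPair_stream_of_recurrence {α : ℝ} {b : ℕ → ℤ} {e : ℕ → ℝ} (h0 : e 0 = α)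
    (h1 : e 1 = 1) (he : ∀ n, e n = b n * e (n + 1) + e (n + 2)) (hpos : ∀ n, 0 < e (n + 1))
    (hb : ∀ n, 1 ≤ n → 1 ≤ b n) (n : ℕ) :
    GenContFract.IntFractPair.stream α n = some ⟨b n, e (n + 2) / e (n + 1)⟩ := by
  have hof (n : ℕ) :
      GenContFract.IntFractPair.of (e n / e (n + 1)) = ⟨b n, e (n + 2) / e (n + 1)⟩ := by
    have hlt : e (n + 2) < e (n + 1) := by
      have hb' : (1 : ℝ) ≤ b (n + 1) := by exact_mod_cast hb (n + 1) (by omega)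
      have h₁ : e (n + 1) = b (n + 1) * e (n + 2) + e (n + 3) := he (n + 1)
      have h₂ : 0 < e (n + 2) := hpos (n + 1)
      have h₃ : 0 < e (n + 3) := hpos (n + 2)
      nlinarith
    have hsplit : e n / e (n + 1) = e (n + 2) / e (n + 1) + b n := by
      rw [he n]
      field_simp [(hpos n).ne']
      ring
    have hfl : ⌊e (n + 2) / e (n + 1)⌋ = 0 :=
      Int.floor_eq_zero_iff.2
        ⟨div_nonneg (hpos (n + 1)).le (hpos n).le, (div_lt_one (hpos n)).2 hlt⟩
    simp only [GenContFract.IntFractPair.of, hsplit, Int.floor_add_intCast,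
      hfl, zero_add, Int.fract]
    simp
  induction n with
  | zero =>
    rw [GenContFract.IntFractPair.stream_zero, ← hof 0, zero_add, h0, h1, div_one]
  | succ n ih =>
    rw [GenContFract.IntFractPair.stream_succ_of_some ih
      (div_pos (hpos (n + 1)) (hpos n)).ne', inv_div, hof (n + 1)]

/-- If a subsequence of the convergents of `[b 0; b 1, …]` tends to `α`, then `α` is irrational
and `[b 0; b 1, …]` is its regular continued fraction expansion. -/
theorem genContFract_of_eq_of_tendsto_convergents {b : ℕ → ℤ} (hb : ∀ n, 1 ≤ n → 1 ≤ b n)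
    {α : ℝ} {φ : ℕ → ℕ} (hφ : Tendsto φ atTop atTop) (hQ : ∀ j, 0 < continuant b 1 0 (φ j))
    (hlim : Tendsto (fun j ↦ (continuant b 0 1 (φ j) : ℝ) / continuant b 1 0 (φ j))
      atTop (𝓝 α)) :
    Irrational α ∧
      (GenContFract.of α).h = (b 0 : ℝ) ∧
      ∀ n : ℕ, (GenContFract.of α).partDens.get? n = some ((b (n + 1) : ℤ) : ℝ) := by
  set e : ℕ → ℝ := fun n ↦ (-1) ^ n * (continuant b 1 0 n * α - continuant b 0 1 n) with he_def
  have he (n : ℕ) : e n = b n * e (n + 1) + e (n + 2) := by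
    simp only [he_def, continuant_add_two]
    push_cast
    ring
  have hnonneg (n : ℕ) : 0 ≤ e (n + 1) := by
    refine ge_of_tendsto (((hlim.const_mul (continuant b 1 0 (n + 1) : ℝ)).sub_const
      (continuant b 0 1 (n + 1) : ℝ)).const_mul ((-1 : ℝ) ^ (n + 1))) ?_
    filter_upwards [hφ.eventually_ge_atTop (n + 1)] with j hj
    obtain ⟨i, hi⟩ := Nat.exists_eq_add_of_le hj
    have hc := continuant_cross_nonneg hb (Nat.le_add_left 1 n) i
    rw [← hi] at hc
    have hc' : (0 : ℝ) ≤ (-1) ^ (n + 1) *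
        (continuant b 1 0 (n + 1) * continuant b 0 1 (φ j) -
          continuant b 0 1 (n + 1) * continuant b 1 0 (φ j)) := by exact_mod_cast hc
    have hQ' : (0 : ℝ) < continuant b 1 0 (φ j) := by exact_mod_cast hQ j
    refine (div_nonneg hc' hQ'.le).trans_eq ?_
    field_simp
  have hpos (n : ℕ) : 0 < e (n + 1) := by
    refine (hnonneg n).lt_of_ne' fun hzero ↦ ?_
    have hzero' : e (n + 2) = 0 := by
      have hb' : (1 : ℝ) ≤ b (n + 1) := by exact_mod_cast hb (n + 1) (by omega)
      have h₁ : e (n + 1) = b (n + 1) * e (n + 2) + e (n + 3) := he (n + 1)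
      have h₂ : 0 ≤ e (n + 2) := hnonneg (n + 1)
      have h₃ : 0 ≤ e (n + 3) := hnonneg (n + 2)
      nlinarith
    have hs (i : ℕ) (hi : e i = 0) : (continuant b 0 1 i : ℝ) = continuant b 1 0 i * α := by
      have := (mul_eq_zero.1 hi).resolve_left (pow_ne_zero i (by norm_num))
      linarith
    have hdet : (continuant b 1 0 (n + 1) * continuant b 0 1 (n + 2) -
      continuant b 0 1 (n + 1) * continuant b 1 0 (n + 2) : ℝ) = (-1) ^ (n + 1) := by
      exact_mod_cast continuant_det b (n + 1)
    rw [hs _ hzero, hs _ hzero'] at hdet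
    exact pow_ne_zero (n + 1) (by norm_num : (-1 : ℝ) ≠ 0) (by rw [← hdet]; ring)
  have hstream := intFractPair_stream_of_recurrence (α := α) (by simp [he_def, continuant])
    (by simp [he_def, continuant]) he hpos hb
  refine ⟨?_, ?_, fun n ↦ ?_⟩
  · rintro ⟨r, hr⟩
    obtain ⟨n, hn⟩ := (GenContFract.terminates_iff_rat α).2 ⟨r, hr.symm⟩
    have := GenContFract.of_terminatedAt_n_iff_succ_nth_intFractPair_stream_eq_none.1 hn
    simp [hstream] at this
  · have h := hstream 0
    rw [GenContFract.IntFractPair.stream_zero, Option.some_inj] at h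
    rw [GenContFract.of_h_eq_intFractPair_seq1_fst_b, GenContFract.IntFractPair.seq1_fst_eq_of, h]
  · exact GenContFract.partDen_eq_s_b
      (GenContFract.get?_of_eq_some_of_succ_get?_intFractPair_stream (hstream (n + 1)))

/-- **Modified Engel series** (Theorem 2.1).
Let `p/q = [a_0; a_1, …, a_{2k}]` be in lowest terms with `q ≥ 1` (convergents `pc, qc`,
indexed so that `pc (n+2), qc (n+2)` are the paper's `p_n, q_n`), let `m ≥ 0`,
let `(u_n)` be positive integers, and define `x 1 = q`, `y 0 = m*q + q_{2k-1} + 1`,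
`y j = y (j-1) * (1 + u j * x j)`, `x (j+1) = x j * y j`.
Then `α = p/q + ∑_{j≥2} 1/x_j` is irrational and its regular continued fraction expansion
`[b_0; b_1, b_2, …]` satisfies `b_j = a_j` for `j ≤ 2k`, `b_{2k+1} = m + u_1 y_0`,
`b_{2k+2j} = x_j` and `b_{2k+2j+1} = u_{j+1} y_j` for `j ≥ 1`. -/
theorem engel_modified_continued_fraction
    (k : ℕ) (a : ℕ → ℤ) (ha : ∀ j, 1 ≤ j → j ≤ 2 * k → 1 ≤ a j)
    (pc qc : ℕ → ℤ)
    (hpc0 : pc 0 = 0) (hpc1 : pc 1 = 1) (hqc0 : qc 0 = 1) (hqc1 : qc 1 = 0)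
    (hpc : ∀ n, pc (n + 2) = a n * pc (n + 1) + pc n)
    (hqc : ∀ n, qc (n + 2) = a n * qc (n + 1) + qc n)
    (p q : ℤ) (hq : 1 ≤ q) (hcop : Int.gcd p q = 1)
    (hp : p = pc (2 * k + 2)) (hqv : q = qc (2 * k + 2))
    (m : ℤ) (hm : 0 ≤ m)
    (u x y : ℕ → ℤ) (hu : ∀ n, 1 ≤ n → 1 ≤ u n)
    (hx1 : x 1 = q) (hy0 : y 0 = m * q + qc (2 * k + 1) + 1)
    (hrec : ∀ j, 1 ≤ j → y j = y (j - 1) * (1 + u j * x j) ∧ x (j + 1) = x j * y j)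
    (α : ℝ) (hα : α = (p : ℝ) / (q : ℝ) + ∑' j : ℕ, (1 : ℝ) / (x (j + 2) : ℝ))
    (b : ℕ → ℤ)
    (hb0 : ∀ j, j ≤ 2 * k → b j = a j)
    (hb1 : b (2 * k + 1) = m + u 1 * y 0)
    (hb2 : ∀ j, 1 ≤ j → b (2 * k + 2 * j) = x j ∧ b (2 * k + 2 * j + 1) = u (j + 1) * y j) :
    Irrational α ∧
      (GenContFract.of α).h = (b 0 : ℝ) ∧
      ∀ n : ℕ, (GenContFract.of α).partDens.get? n = some ((b (n + 1) : ℤ) : ℝ) := by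
  have hqc_nonneg : 0 ≤ qc (2 * k + 1) :=
    continuant_denom_nonneg hqc0 hqc1 hqc (N := 2 * k)
      (fun n h h' ↦ ha n h h'.le) _ le_rfl
  have hxy (j : ℕ) : 2 ^ j ≤ x (j + 1) ∧ 1 ≤ y j := by
    induction j with
    | zero => exact ⟨by simpa [hx1] using hq, by rw [hy0]; nlinarith⟩
    | succ j ih =>
      obtain ⟨hx, hy⟩ := ih
      obtain ⟨hy', hx'⟩ := hrec (j + 1) (by omega)
      have hu' := hu (j + 1) (by omega)
      have hx_pos : 0 < x (j + 1) := lt_of_lt_of_le (by positivity) hx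
      have hux : 1 ≤ u (j + 1) * x (j + 1) := one_le_mul_of_one_le_of_one_le hu' hx_pos
      rw [Nat.add_sub_cancel] at hy'
      have hy2 : 2 ≤ y (j + 1) := by rw [hy']; nlinarith
      refine ⟨?_, by omega⟩
      rw [hx', pow_succ]
      exact mul_le_mul hx hy2 (by norm_num) hx_pos.le
  have hx_pos (j : ℕ) : 0 < x (j + 1) := lt_of_lt_of_le (by positivity) (hxy j).1
  have hb (n : ℕ) (hn : 1 ≤ n) : 1 ≤ b n := by
    rcases le_or_gt n (2 * k) with hle | hlt
    · rw [hb0 n hle]; exact ha n hn hle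
    obtain ⟨i, rfl⟩ := Nat.exists_eq_add_of_lt hlt
    rcases Nat.even_or_odd' i with ⟨j, rfl | rfl⟩
    · have h := one_le_mul_of_one_le_of_one_le (hu (j + 1) (by omega)) (hxy j).2
      rcases Nat.eq_zero_or_pos j with rfl | hj
      · rw [show 2 * k + 2 * 0 + 1 = 2 * k + 1 by ring, hb1]
        rw [zero_add] at h
        omega
      · rw [(hb2 j hj).2]
        exact h
    · rw [show 2 * k + (2 * j + 1) + 1 = 2 * k + 2 * (j + 1) by ring, (hb2 (j + 1) (by omega)).1]
      exact hx_pos j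
  have hP := eq_continuant (N := 2 * k + 1) hpc0 hpc1 hpc (fun n hn ↦ hb0 n (by omega))
  have hQ := eq_continuant (N := 2 * k + 1) hqc0 hqc1 hqc (fun n hn ↦ hb0 n (by omega))
  have hden (j : ℕ) : continuant b 1 0 (2 * k + 2 * j + 2) = x (j + 1) ∧
      continuant b 1 0 (2 * k + 2 * j + 3) = y (j + 1) - 1 := by
    induction j with
    | zero =>
      have h₂ : continuant b 1 0 (2 * k + 2) = x 1 := by rw [hx1, hqv, hQ _ (by omega)]
      refine ⟨h₂, ?_⟩
      have hy := (hrec 1 le_rfl).1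
      rw [Nat.sub_self] at hy
      rw [mul_zero, add_zero, show 2 * k + 3 = 2 * k + 1 + 2 by ring, continuant_add_two, h₂,
        ← hQ (2 * k + 1) (by omega), hb1, zero_add, hy]
      linear_combination m * hx1 - hy0
    | succ j ih =>
      obtain ⟨h₁, h₂⟩ := ih
      have hy := (hrec (j + 2) (by omega)).1
      have hx := (hrec (j + 1) (by omega)).2
      rw [show j + 2 - 1 = j + 1 by omega] at hy
      obtain ⟨hbx, hby⟩ := hb2 (j + 1) (by omega)
      have h₃ : continuant b 1 0 (2 * k + 2 * (j + 1) + 2) = x (j + 2) := by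
        rw [continuant_add_two, hbx]
        rw [show 2 * k + 2 * (j + 1) + 1 = 2 * k + 2 * j + 3 by ring, h₂,
          show 2 * k + 2 * (j + 1) = 2 * k + 2 * j + 2 by ring, h₁, hx]
        ring
      refine ⟨h₃, ?_⟩
      rw [show 2 * k + 2 * (j + 1) + 3 = 2 * k + 2 * (j + 1) + 1 + 2 by ring, continuant_add_two,
        hby, h₃, show 2 * k + 2 * (j + 1) + 1 = 2 * k + 2 * j + 3 by ring, h₂, hy]
      ring
  have hsum : Summable fun j : ℕ ↦ (1 : ℝ) / (x (j + 2) : ℝ) := by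
    refine Summable.of_nonneg_of_le (fun j ↦ ?_) (fun j ↦ ?_) summable_geometric_two
    · have : (0 : ℝ) < x (j + 2) := by exact_mod_cast hx_pos (j + 1)
      positivity
    · have : (2 : ℝ) ^ (j + 1) ≤ x (j + 2) := by exact_mod_cast (hxy (j + 1)).1
      rw [one_div_pow]
      refine one_div_le_one_div_of_le (by positivity) (le_trans ?_ this)
      exact pow_le_pow_right₀ (by norm_num) j.le_succ
  have hconv (j : ℕ) : (continuant b 0 1 (2 * k + 2 * j + 2) : ℝ) /
      continuant b 1 0 (2 * k + 2 * j + 2) =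
        (p : ℝ) / q + ∑ i ∈ Finset.range j, (1 : ℝ) / (x (i + 2) : ℝ) := by
    induction j with
    | zero => simp [hp, hqv, hP (2 * k + 2), hQ (2 * k + 2)]
    | succ j ih =>
      rw [Finset.sum_range_succ, ← add_assoc, ← ih, (hden j).1, (hden (j + 1)).1]
      have hdet := continuant_det b (2 * k + 2 * j + 2)
      rw [(show Even (2 * k + 2 * j + 2) from ⟨k + j + 1, by ring⟩).neg_one_pow, (hden j).1] at hdet
      have hQ' := continuant_add_two b 1 0 (2 * k + 2 * j + 2)
      have hP' := continuant_add_two b 0 1 (2 * k + 2 * j + 2)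
      have hbx := (hb2 (j + 1) (by omega)).1
      rw [show 2 * k + 2 * (j + 1) = 2 * k + 2 * j + 2 by ring] at hbx ⊢
      have hxx : continuant b 1 0 (2 * k + 2 * j + 2 + 2) = x (j + 2) := (hden (j + 1)).1
      rw [hxx, hbx, (hden j).1] at hQ'
      rw [hbx] at hP'
      have key : continuant b 0 1 (2 * k + 2 * j + 2 + 2) * x (j + 1) =
          continuant b 0 1 (2 * k + 2 * j + 2) * x (j + 2) + x (j + 1) := by
        linear_combination x (j + 1) * hP' - continuant b 0 1 (2 * k + 2 * j + 2) * hQ' +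
          x (j + 1) * hdet
      have key' : (continuant b 0 1 (2 * k + 2 * j + 2 + 2) * x (j + 1) : ℝ) =
          continuant b 0 1 (2 * k + 2 * j + 2) * x (j + 2) + x (j + 1) := by exact_mod_cast key
      have h₁ : (x (j + 1) : ℝ) ≠ 0 := by exact_mod_cast (hx_pos j).ne'
      have h₂ : (x (j + 2) : ℝ) ≠ 0 := by exact_mod_cast (hx_pos (j + 1)).ne'
      rw [show j + 1 + 1 = j + 2 by ring]
      field_simp
      linear_combination key'
  refine genContFract_of_eq_of_tendsto_convergents hb (φ := fun j ↦ 2 * k + 2 * j + 2)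
    (tendsto_atTop_mono (fun j ↦ by rw [id_eq]; omega) tendsto_id) (fun j ↦ ?_) ?_
  · rw [(hden j).1]
    exact hx_pos j
  · simp only [hconv, hα]
    exact hsum.hasSum.tendsto_sum_nat.const_add _
end

section
/- Extend the partial quotients by b_j = a_j for 0 ≤ j ≤ 2k, b_{2k+1} = m + u_1·y_0 − 1, and b_{2k+3j−1} = 1, b_{2k+3j} = x_j − 1, b_{2k+3j+1} = u_{j+1}·y_j − 1 for j ≥ 1, and let P_n, Q_n denote the numerators and denominators of the corresponding convergents (satisfying the standard three-term recurrences). Then for every N ≥ 1 the N-th partial sum satisfies p/q + Σ_{j=2}^N (−1)^j/x_j = P_{2k+3N−3}/Q_{2k+3N−3}, and the denominators satisfy Q_{2k+3N−3} = x_N, Q_{2k+3N−2} = y_N − x_N + 1, and Q_{2k+3N−1} = y_N + 1. -/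
open Filter Topology

/-- Two sequences with the same initial values and the same linear recurrence up to an index agree
up to that index. -/
lemma threeTerm_congr {a b f g : ℕ → ℤ} (h0 : f 0 = g 0) (h1 : f 1 = g 1)
    (hf : ∀ n, f (n + 2) = b n * f (n + 1) + f n) (hg : ∀ n, g (n + 2) = a n * g (n + 1) + g n)
    {l : ℕ} (hab : ∀ j ≤ l, b j = a j) : ∀ n ≤ l + 1, f n = g n ∧ f (n + 1) = g (n + 1) := by
  intro n
  induction n with
  | zero => exact fun _ => ⟨h0, h1⟩
  | succ n ih =>
    intro hn
    obtain ⟨e0, e1⟩ := ih (by omega)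
    exact ⟨e1, by rw [hf, hg, hab n (by omega), e0, e1]⟩

/-- The determinant identity for consecutive convergents. -/
lemma convergents_det {b P Q : ℕ → ℤ} (hP0 : P 0 = 0) (hP1 : P 1 = 1) (hQ0 : Q 0 = 1)
    (hQ1 : Q 1 = 0) (hP : ∀ n, P (n + 2) = b n * P (n + 1) + P n)
    (hQ : ∀ n, Q (n + 2) = b n * Q (n + 1) + Q n) (n : ℕ) :
    P (n + 1) * Q n - P n * Q (n + 1) = (-1) ^ n := by
  induction n with
  | zero => simp [hP0, hP1, hQ0, hQ1]
  | succ n ih =>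
    rw [hP, hQ, pow_succ, ← ih]
    ring

/-- The denominators of a regular continued fraction are positive. -/
lemma denominators_pos {a Q : ℕ → ℤ} (hQ0 : Q 0 = 1) (hQ1 : Q 1 = 0)
    (hQ : ∀ n, Q (n + 2) = a n * Q (n + 1) + Q n) {l : ℕ} (ha : ∀ j, 1 ≤ j → j ≤ l → 1 ≤ a j) :
    ∀ n ≤ l, 0 ≤ Q (n + 1) ∧ 0 < Q (n + 2) := by
  intro n
  induction n with
  | zero =>
    intro _
    simp [hQ 0, hQ0, hQ1]
  | succ n ih =>
    intro hn
    obtain ⟨e0, e1⟩ := ih (by omega)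
    have e2 := ha (n + 1) (by omega) hn
    refine ⟨e1.le, ?_⟩
    rw [hQ (n + 1)]
    exact add_pos_of_pos_of_nonneg (mul_pos (zero_lt_one.trans_le e2) e1) e0

/-- The sequences `x` and `y` of the nonlinear recurrence stay positive. -/
lemma pierceRec_pos {u x y : ℕ → ℤ} (hu : ∀ n, 1 ≤ n → 1 ≤ u n) (hx1 : 0 < x 1) (hy0 : 0 < y 0)
    (hrec : ∀ j, 1 ≤ j → y j = y (j - 1) * (1 + u j * x j) ∧ x (j + 1) = x j * y j) (n : ℕ) :
    0 < x (n + 1) ∧ 0 < y n := by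
  induction n with
  | zero => exact ⟨hx1, hy0⟩
  | succ n ih =>
    obtain ⟨hx, hy⟩ := ih
    obtain ⟨ey, ex⟩ := hrec (n + 1) (by omega)
    have hu' : 0 < u (n + 1) := hu (n + 1) (by omega)
    have hy' : 0 < y (n + 1) := by
      rw [ey, Nat.add_sub_cancel]
      positivity
    exact ⟨ex ▸ mul_pos hx hy', hy'⟩

/-- **Partial sums of the rational-plus-Pierce series are convergents** (key step in
Theorem 2.2).  With the setup of Theorem 2.2, extend the partial quotients `b` and form the
convergent numerators `P` and denominators `Q` (indexed so that `P (n+2), Q (n+2)` are the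
paper's `P_n, Q_n`, with `P 0 = 0, P 1 = 1, Q 0 = 1, Q 1 = 0`).  Then for every `N ≥ 1`,
`p/q + ∑_{j=2}^N (-1)^j/x_j = P_{2k+3N-3}/Q_{2k+3N-3}`, with `Q_{2k+3N-3} = x_N`,
`Q_{2k+3N-2} = y_N - x_N + 1` and `Q_{2k+3N-1} = y_N + 1`. -/
theorem pierce_added_partial_sums
    (k : ℕ) (a : ℕ → ℤ) (ha : ∀ j, 1 ≤ j → j ≤ 2 * k → 1 ≤ a j)
    (pc qc : ℕ → ℤ)
    (hpc0 : pc 0 = 0) (hpc1 : pc 1 = 1) (hqc0 : qc 0 = 1) (hqc1 : qc 1 = 0)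
    (hpc : ∀ n, pc (n + 2) = a n * pc (n + 1) + pc n)
    (hqc : ∀ n, qc (n + 2) = a n * qc (n + 1) + qc n)
    (p q : ℤ) (hq : 1 < q) (hcop : Int.gcd p q = 1)
    (hp : p = pc (2 * k + 2)) (hqv : q = qc (2 * k + 2))
    (m : ℤ) (hm : 0 ≤ m) (hm1 : qc (2 * k + 1) = 1 → 1 ≤ m)
    (u x y : ℕ → ℤ) (hu : ∀ n, 1 ≤ n → 1 ≤ u n)
    (hx1 : x 1 = q) (hy0 : y 0 = m * q + qc (2 * k + 1) - 1)
    (hrec : ∀ j, 1 ≤ j → y j = y (j - 1) * (1 + u j * x j) ∧ x (j + 1) = x j * y j)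
    (b : ℕ → ℤ)
    (hb0 : ∀ j, j ≤ 2 * k → b j = a j)
    (hb1 : b (2 * k + 1) = m + u 1 * y 0 - 1)
    (hb2 : ∀ j, 1 ≤ j →
      b (2 * k + 3 * j - 1) = 1 ∧
      b (2 * k + 3 * j) = x j - 1 ∧
      b (2 * k + 3 * j + 1) = u (j + 1) * y j - 1)
    (P Q : ℕ → ℤ)
    (hP0 : P 0 = 0) (hP1 : P 1 = 1) (hQ0 : Q 0 = 1) (hQ1 : Q 1 = 0)
    (hP : ∀ n, P (n + 2) = b n * P (n + 1) + P n)
    (hQ : ∀ n, Q (n + 2) = b n * Q (n + 1) + Q n) :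
    ∀ N : ℕ, 1 ≤ N →
      ((p : ℝ) / (q : ℝ) + ∑ j ∈ Finset.Icc 2 N, (-1 : ℝ) ^ j / (x j : ℝ)
          = (P (2 * k + 3 * N - 1) : ℝ) / (Q (2 * k + 3 * N - 1) : ℝ)) ∧
      Q (2 * k + 3 * N - 1) = x N ∧
      Q (2 * k + 3 * N) = y N - x N + 1 ∧
      Q (2 * k + 3 * N + 1) = y N + 1 := by
  have hQc := threeTerm_congr (hQ0.trans hqc0.symm) (hQ1.trans hqc1.symm) hQ hqc hb0 (2 * k + 1) le_rfl
  have hPc := threeTerm_congr (hP0.trans hpc0.symm) (hP1.trans hpc1.symm) hP hpc hb0 (2 * k + 1) le_rfl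
  have hy0pos : 0 < y 0 := by
    have hk : k ≠ 0 := by
      rintro rfl
      have := hqc 0
      simp only [hqc0, hqc1] at this
      simp [this] at hqv
      omega
    have hqpos : 0 < qc (2 * k + 1) := by
      have := (denominators_pos hqc0 hqc1 hqc ha (2 * k - 1) (by omega)).2
      rwa [show 2 * k - 1 + 2 = 2 * k + 1 by omega] at this
    rw [hy0]
    by_cases h1 : qc (2 * k + 1) = 1
    · have := hm1 h1
      nlinarith
    · have : 2 ≤ qc (2 * k + 1) := by omega
      nlinarith
  have hpos := pierceRec_pos hu (by omega) hy0pos hrec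
  have hdet := convergents_det hP0 hP1 hQ0 hQ1 hP hQ
  suffices H : ∀ M : ℕ,
      ((p : ℝ) / (q : ℝ) + ∑ j ∈ Finset.Icc 2 (M + 1), (-1 : ℝ) ^ j / (x j : ℝ)
          = (P (2 * k + 3 * M + 2) : ℝ) / (Q (2 * k + 3 * M + 2) : ℝ)) ∧
      Q (2 * k + 3 * M + 2) = x (M + 1) ∧
      Q (2 * k + 3 * M + 3) = y (M + 1) - x (M + 1) + 1 ∧
      Q (2 * k + 3 * M + 4) = y (M + 1) + 1 by
    intro N hN
    obtain ⟨M, rfl⟩ := Nat.exists_eq_add_of_le' hN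
    exact H M
  intro M
  induction M with
  | zero =>
    have e2 : Q (2 * k + 2) = x 1 := by rw [hQc.2, hx1, hqv]
    have e3 : Q (2 * k + 3) = y 1 - x 1 + 1 := by
      have hy1 := (hrec 1 le_rfl).1
      rw [Nat.sub_self, hx1] at hy1
      rw [hQ (2 * k + 1), hQc.1, hb1, e2, hx1, hy1]
      linear_combination -hy0
    have e4 : Q (2 * k + 4) = y 1 + 1 := by
      have hb : b (2 * k + 2) = 1 := (hb2 1 le_rfl).1
      rw [hQ (2 * k + 2), hb, e3, e2]
      ring
    refine ⟨?_, e2, e3, e4⟩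
    simp [hPc.2, hQc.2, hp, hqv]
  | succ M ih =>
    obtain ⟨hsum, e2, e3, e4⟩ := ih
    obtain ⟨-, hbx, hbu⟩ := hb2 (M + 1) (by omega)
    have hbone := (hb2 (M + 1) (by omega)).1
    have hbone' := (hb2 (M + 2) (by omega)).1
    rw [show 2 * k + 3 * (M + 1) - 1 = 2 * k + 3 * M + 2 by omega] at hbone
    rw [show 2 * k + 3 * (M + 2) - 1 = 2 * k + 3 * M + 5 by omega] at hbone'
    rw [show 2 * k + 3 * (M + 1) = 2 * k + 3 * M + 3 by omega] at hbx hbu ⊢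
    have hx := (hrec (M + 1) (by omega)).2
    have hy := (hrec (M + 2) (by omega)).1
    rw [show M + 2 - 1 = M + 1 by omega] at hy
    have e5 : Q (2 * k + 3 * M + 5) = x (M + 2) := by
      rw [hQ (2 * k + 3 * M + 3), hbx, e4, e3, hx]
      ring
    have e6 : Q (2 * k + 3 * M + 6) = y (M + 2) - x (M + 2) + 1 := by
      rw [hQ (2 * k + 3 * M + 4), hbu, e5, e4, hy]
      ring
    have e7 : Q (2 * k + 3 * M + 7) = y (M + 2) + 1 := by
      rw [hQ (2 * k + 3 * M + 5), hbone', e6, e5]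
      ring
    refine ⟨?_, e5, e6, e7⟩
    have hP5 : P (2 * k + 3 * M + 5)
        = x (M + 1) * P (2 * k + 3 * M + 3) + (x (M + 1) - 1) * P (2 * k + 3 * M + 2) := by
      rw [hP (2 * k + 3 * M + 3), hbx, hP (2 * k + 3 * M + 2), hbone]
      ring
    have hd := hdet (2 * k + 3 * M + 2)
    rw [show ((-1 : ℤ)) ^ (2 * k + 3 * M + 2) = (-1) ^ M by
      rw [show 2 * k + 3 * M + 2 = 2 * (k + M + 1) + M by ring, pow_add, pow_mul]; simp,
      e2, e3] at hd
    have hxpos : (0 : ℝ) < x (M + 1) := by exact_mod_cast (hpos M).1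
    have hypos : (0 : ℝ) < y (M + 1) := by exact_mod_cast (hpos (M + 1)).2
    rw [Finset.sum_Icc_succ_top (by omega), ← add_assoc, hsum, e2]
    change _ + (-1 : ℝ) ^ (M + 2) / (x (M + 2) : ℝ)
      = (P (2 * k + 3 * M + 5) : ℝ) / (Q (2 * k + 3 * M + 5) : ℝ)
    have hd' : (P (2 * k + 3 * M + 3) : ℝ) * x (M + 1)
        - P (2 * k + 3 * M + 2) * (y (M + 1) - x (M + 1) + 1) = (-1) ^ M := by
      exact_mod_cast hd
    rw [e5, hP5, hx, pow_add, ← hd']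
    push_cast
    field_simp
    ring
end

section
/- The sequence (x_n) satisfies the nonlinear recurrence x_{n+1}·x_{n−1} = x_n²·(1 + u_n·x_n) for all n ≥ 2; consequently x_{n+1} > x_n² holds for all n ≥ 2, and x_{n+1} > x_n^{5/2} holds for all n ≥ 3. -/
theorem rpow_five_halves_lt_of_pow_lt {a b : ℝ} (ha : 0 ≤ a) (hb : 0 ≤ b)
    (h : a ^ 5 < b ^ 2) : a ^ ((5 : ℝ) / 2) < b := by
  refine lt_of_pow_lt_pow_left₀ 2 hb ?_
  have key : (a ^ ((5 : ℝ) / 2)) ^ 2 = a ^ 5 := by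
    rw [← Real.rpow_mul_natCast ha, ← Real.rpow_natCast a 5]
    norm_num
  rwa [key]

/-- Eliminating `a` from `a ^ 2 < b` and `b ^ 3 < c * a` gives `b ^ 5 < c ^ 2`. -/
theorem pow_five_lt_sq_of_cube_lt_mul {a b c : ℤ} (hb : 0 < b)
    (hab : a ^ 2 < b) (h : b ^ 3 < c * a) : b ^ 5 < c ^ 2 := by
  have h6 : (b ^ 3) ^ 2 < (c * a) ^ 2 := pow_lt_pow_left₀ h (by positivity) two_ne_zero
  have hca : c ^ 2 * a ^ 2 ≤ c ^ 2 * b := mul_le_mul_of_nonneg_left hab.le (sq_nonneg c)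
  refine lt_of_mul_lt_mul_right ?_ hb.le
  calc b ^ 5 * b = (b ^ 3) ^ 2 := by ring
    _ < c ^ 2 * a ^ 2 := by rwa [← mul_pow]
    _ ≤ c ^ 2 * b := hca

/-- The sequence `(x_n)` defined by `x 1 = q`, `y j = y (j-1) * (1 + u j * x j)`,
`x (j+1) = x j * y j` (with `q ≥ 1`, `y 0 ≥ 1` and positive integers `u_n`) satisfies the
nonlinear recurrence `x_{n+1} x_{n-1} = x_n^2 (1 + u_n x_n)` for `n ≥ 2`; consequently
`x_{n+1} > x_n^2` for all `n ≥ 2` and `x_{n+1} > x_n^{5/2}` for all `n ≥ 3`. -/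
theorem engel_sequence_growth
    (q : ℤ) (hq : 1 ≤ q)
    (u x y : ℕ → ℤ) (hu : ∀ n, 1 ≤ n → 1 ≤ u n)
    (hx1 : x 1 = q) (hy0 : 1 ≤ y 0)
    (hrec : ∀ j, 1 ≤ j → y j = y (j - 1) * (1 + u j * x j) ∧ x (j + 1) = x j * y j) :
    (∀ n, 2 ≤ n → x (n + 1) * x (n - 1) = x n ^ 2 * (1 + u n * x n)) ∧
    (∀ n, 2 ≤ n → x n ^ 2 < x (n + 1)) ∧
    (∀ n, 3 ≤ n → (x n : ℝ) ^ ((5 : ℝ) / 2) < (x (n + 1) : ℝ)) := by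
  have pos : ∀ n, 1 ≤ y n ∧ 1 ≤ x (n + 1) := by
    intro n
    induction n with
    | zero => exact ⟨hy0, by simpa [hx1] using hq⟩
    | succ k ih =>
      obtain ⟨hyk, hxk⟩ := ih
      obtain ⟨hy, hx⟩ := hrec (k + 1) (by omega)
      have huk := hu (k + 1) (by omega)
      rw [Nat.add_sub_cancel] at hy
      have hy1 : 0 < y (k + 1) := by rw [hy]; positivity
      have hx1 : 0 < x (k + 1 + 1) := by rw [hx]; positivity
      exact ⟨hy1, hx1⟩
  have recurrence : ∀ n, 2 ≤ n → x (n + 1) * x (n - 1) = x n ^ 2 * (1 + u n * x n) := by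
    intro n hn
    obtain ⟨hy, hx⟩ := hrec n (by omega)
    have hx' := (hrec (n - 1) (by omega)).2
    rw [Nat.sub_add_cancel (by omega)] at hx'
    rw [hx, hy]
    linear_combination (-(x n * (1 + u n * x n))) * hx'
  have sq_lt : ∀ n, 1 ≤ n → x n ^ 2 < x (n + 1) := by
    intro n hn
    obtain ⟨hy, hx⟩ := hrec n hn
    obtain ⟨hyp, hxp⟩ := pos (n - 1)
    rw [Nat.sub_add_cancel hn] at hxp
    have hux : x n ≤ u n * x n := le_mul_of_one_le_left (by omega) (hu n hn)
    have hlt : x n < y n := by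
      rw [hy]
      exact lt_of_lt_of_le (by omega) (le_mul_of_one_le_left (by omega) hyp)
    rw [hx, sq]
    exact mul_lt_mul_of_pos_left hlt (by omega)
  refine ⟨recurrence, fun n hn => sq_lt n (by omega), fun n hn => ?_⟩
  obtain ⟨m, rfl⟩ : ∃ m, n = m + 1 := ⟨n - 1, by omega⟩
  have hxp : 0 < x (m + 1) := (pos m).2
  have hxp' : 0 < x (m + 1 + 1) := (pos (m + 1)).2
  have hcube : x (m + 1) ^ 3 < x (m + 1 + 1) * x m := by
    have hr := recurrence (m + 1) (by omega)
    rw [Nat.add_sub_cancel] at hr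
    rw [hr, pow_succ]
    have hux : x (m + 1) ≤ u (m + 1) * x (m + 1) :=
      le_mul_of_one_le_left hxp.le (hu _ (by omega))
    exact mul_lt_mul_of_pos_left (by omega) (by positivity)
  have hpow := pow_five_lt_sq_of_cube_lt_mul hxp (sq_lt m (by omega)) hcube
  exact rpow_five_halves_lt_of_pow_lt (by exact_mod_cast hxp.le) (by exact_mod_cast hxp'.le)
    (by exact_mod_cast hpow)
end

section
/- For every ε > 0 there exists N such that x_{n+1} > x_n^{μ* − ε} for all n ≥ N, where μ* = (3 + √5)/2. -/
open Real in
/-- If `M ≥ (φ - c) L`, one step `L ↦ L + M`, `M ↦ M + (L + M)` of the (logarithmic) recursion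
halves the defect `c`. -/
lemma goldenRatio_defect_step {c L M M' : ℝ} (hc : 0 ≤ c) (hcφ : c ≤ goldenRatio) (hL : 0 ≤ L)
    (hM : (goldenRatio - c) * L ≤ M) (hM' : M + (L + M) ≤ M') :
    (goldenRatio - c / 2) * (L + M) ≤ M' := by
  have hsq : goldenRatio ^ 2 = goldenRatio + 1 := goldenRatio_sq
  have hlt : goldenRatio < 2 := goldenRatio_lt_two
  have hgt : 3 / 2 ≤ goldenRatio := by nlinarith [goldenRatio_pos]
  have hcoef : 0 ≤ 2 - goldenRatio + c / 2 := by linarith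
  have hmul := mul_le_mul_of_nonneg_left hM hcoef
  have hrest : 0 ≤ L * (c * (3 * goldenRatio - 3 - c)) :=
    mul_nonneg hL (mul_nonneg hc (by linarith))
  have hid : (2 - goldenRatio + c / 2) * ((goldenRatio - c) * L)
      + (1 - goldenRatio + c / 2) * L = L * (c * (3 * goldenRatio - 3 - c)) / 2 := by
    linear_combination (-L) * hsq
  linarith

open Real in
/-- Iterating `goldenRatio_defect_step` from `M 0 ≥ 0`. -/
lemma goldenRatio_defect_le {L M : ℕ → ℝ} (hL : ∀ k, 0 ≤ L k) (hM0 : 0 ≤ M 0)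
    (hLs : ∀ k, L (k + 1) = L k + M k) (hMs : ∀ k, M k + L (k + 1) ≤ M (k + 1)) (k : ℕ) :
    (goldenRatio - goldenRatio * (1 / 2) ^ k) * L k ≤ M k := by
  induction k with
  | zero => simpa using hM0
  | succ k ih =>
    have hpow : ((1 : ℝ) / 2) ^ k ≤ 1 := pow_le_one₀ (by norm_num) (by norm_num)
    have hstep := goldenRatio_defect_step (by have := goldenRatio_pos; positivity)
      (mul_le_of_le_one_right goldenRatio_pos.le hpow) (hL k) ih (hLs k ▸ hMs k)
    rw [hLs, pow_succ]
    convert hstep using 2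
    ring

lemma engel_sequence_pos {u x y : ℕ → ℤ} (hu : ∀ n, 1 ≤ n → 1 ≤ u n)
    (hx1 : 1 ≤ x 1) (hy0 : 1 ≤ y 0)
    (hrec : ∀ j, 1 ≤ j → y j = y (j - 1) * (1 + u j * x j) ∧ x (j + 1) = x j * y j) (j : ℕ) :
    1 ≤ x (j + 1) ∧ 1 ≤ y j := by
  induction j with
  | zero => exact ⟨hx1, hy0⟩
  | succ j ih =>
    obtain ⟨hx, hy⟩ := ih
    obtain ⟨hy', hx'⟩ := hrec (j + 1) (by omega)
    have hu' := hu (j + 1) (by omega)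
    have hyj : 1 ≤ y (j + 1) := by
      rw [hy', Nat.add_sub_cancel]
      exact one_le_mul_of_one_le_of_one_le hy (by nlinarith)
    exact ⟨hx' ▸ one_le_mul_of_one_le_of_one_le hx hyj, hyj⟩


/-- **Lemma 3.1.** For the sequence `(x_n)` defined by `x 1 = q`,
`y j = y (j-1) * (1 + u j * x j)`, `x (j+1) = x j * y j` (with `q ≥ 1`, `y 0 ≥ 1` and positive
integers `u_n`): for all `ε > 0` there is some `N` such that `x_{n+1} > x_n^{μ* - ε}` for all
`n ≥ N`, where `μ* = (3 + √5)/2`. -/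
theorem engel_sequence_growth_exponent
    (q : ℤ) (hq : 1 ≤ q)
    (u x y : ℕ → ℤ) (hu : ∀ n, 1 ≤ n → 1 ≤ u n)
    (hx1 : x 1 = q) (hy0 : 1 ≤ y 0)
    (hrec : ∀ j, 1 ≤ j → y j = y (j - 1) * (1 + u j * x j) ∧ x (j + 1) = x j * y j) :
    ∀ ε : ℝ, 0 < ε → ∃ N : ℕ, ∀ n, N ≤ n →
      (x n : ℝ) ^ ((3 + Real.sqrt 5) / 2 - ε) < (x (n + 1) : ℝ) := by
  intro ε hε
  have hpos := engel_sequence_pos hu (hx1 ▸ hq) hy0 hrec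
  have hx (k : ℕ) : (1 : ℝ) ≤ x (k + 1) := by exact_mod_cast (hpos k).1
  have hy (k : ℕ) : (1 : ℝ) ≤ y k := by exact_mod_cast (hpos k).2
  have hyrec (k : ℕ) : (y k : ℝ) * (1 + u (k + 1) * x (k + 1)) = y (k + 1) := by
    exact_mod_cast (hrec (k + 1) (by omega)).1.symm
  have hxrec (k : ℕ) : (x (k + 2) : ℝ) = x (k + 1) * y (k + 1) := by
    exact_mod_cast (hrec (k + 1) (by omega)).2
  have hymul (k : ℕ) : (y k : ℝ) * x (k + 1) < y (k + 1) := by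
    have hu' : (1 : ℝ) ≤ u (k + 1) := by exact_mod_cast hu (k + 1) (by omega)
    rw [← hyrec k]
    exact mul_lt_mul_of_pos_left (by nlinarith [hx k]) (by linarith [hy k])
  have hx_gt (k : ℕ) : (1 : ℝ) < x (k + 2) := by
    rw [hxrec]
    exact one_lt_mul_of_le_of_lt (hx k)
      ((one_le_mul_of_one_le_of_one_le (hy k) (hx k)).trans_lt (hymul k))
  have hlog (k : ℕ) : Real.log (x (k + 2)) = Real.log (x (k + 1)) + Real.log (y (k + 1)) := by
    rw [hxrec, Real.log_mul (by linarith [hx k]) (by linarith [hy (k + 1)])]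
  have hdefect := goldenRatio_defect_le (L := fun k => Real.log (x (k + 1)))
    (M := fun k => Real.log (y (k + 1))) (fun k => Real.log_nonneg (hx k))
    (Real.log_nonneg (hy 1)) hlog (fun k => by
      rw [← Real.log_mul (by linarith [hy (k + 1)]) (by linarith [hx (k + 1)])]
      exact Real.log_le_log (by nlinarith [hy (k + 1), hx (k + 1)]) (hymul (k + 1)).le)
  obtain ⟨K, hK⟩ := exists_pow_lt_of_lt_one (div_pos hε Real.goldenRatio_pos)
    (by norm_num : (1 / 2 : ℝ) < 1)
  refine ⟨K + 2, fun n hn => ?_⟩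
  obtain ⟨k, rfl⟩ := Nat.exists_eq_add_of_le' (show 2 ≤ n by omega)
  have hpow : Real.goldenRatio * (1 / 2) ^ (k + 1) < ε := by
    rw [mul_comm, ← lt_div_iff₀ Real.goldenRatio_pos]
    exact (pow_le_pow_of_le_one (by norm_num) (by norm_num) (by omega)).trans_lt hK
  have hlog_pos := Real.log_pos (hx_gt k)
  rw [Real.rpow_lt_iff_lt_log (by linarith [hx_gt k]) (by linarith [hx_gt (k + 1)]),
    hlog (k + 1)]
  have hμ : (3 + Real.sqrt 5) / 2 = 1 + Real.goldenRatio := by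
    rw [Real.goldenRatio]; ring
  rw [hμ]
  nlinarith [hdefect (k + 1), mul_lt_mul_of_pos_right hpow hlog_pos]
end

section
/- Let α = p/q + Σ_{j=2}^∞ 1/x_j. Then α is transcendental, and its irrationality exponent satisfies μ(α) ≥ (3 + √5)/2. -/
/-- The set of "good rational approximations" `P/Q` (with `Q ≥ 1`) to `α` for exponent `μ`:
pairs `(P, Q)` with `0 < |α - P/Q| < 1/Q^μ`.  The irrationality exponent of `α` is the
supremum of the set of `μ` for which this set is infinite. -/
def approxSet (α μ : ℝ) : Set (ℤ × ℤ) :=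
  {PQ | 1 ≤ PQ.2 ∧ 0 < |α - (PQ.1 : ℝ) / (PQ.2 : ℝ)| ∧
    |α - (PQ.1 : ℝ) / (PQ.2 : ℝ)| < 1 / (PQ.2 : ℝ) ^ μ}

open Polynomial in
theorem natDegree_eq_of_wronskian_eq_zero {f g : ℝ[X]} (hf : f ≠ 0) (hg : g ≠ 0)
    (h : f * derivative g = derivative f * g) : f.natDegree = g.natDegree := by
  have hX : ∀ (p : ℝ[X]) (n : ℕ), (X * derivative p).coeff n = n * p.coeff n := by
    intro p n
    cases n with
    | zero => simp
    | succ n => rw [coeff_X_mul, coeff_derivative]; push_cast; ring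
  have hXd : ∀ p : ℝ[X], (X * derivative p).natDegree ≤ p.natDegree := by
    intro p
    rw [natDegree_le_iff_coeff_eq_zero]
    intro n hn
    rw [hX, coeff_eq_zero_of_natDegree_lt hn, mul_zero]
  have h' : f * (X * derivative g) = (X * derivative f) * g := by
    linear_combination X * h
  have hc := congrArg (fun p => coeff p (f.natDegree + g.natDegree)) h'
  beta_reduce at hc
  rw [coeff_mul_add_eq_of_natDegree_le le_rfl (hXd g), coeff_mul_add_eq_of_natDegree_le (hXd f) le_rfl, hX, hX]
    at hc
  have h1 : f.coeff f.natDegree ≠ 0 := by simpa using hf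
  have h2 : g.coeff g.natDegree ≠ 0 := by simpa using hg
  have h3 : (f.coeff f.natDegree * g.coeff g.natDegree) * ((g.natDegree : ℝ) - f.natDegree) = 0 := by
    linear_combination hc
  have h4 := (mul_eq_zero.1 h3).resolve_left (mul_ne_zero h1 h2)
  exact_mod_cast (sub_eq_zero.1 h4).symm

open Polynomial in
/-- Proportionality from a vanishing Wronskian. -/
theorem exists_eq_C_mul_of_wronskian_eq_zero {f g : ℝ[X]} (hf : f ≠ 0)
    (h : f * derivative g = derivative f * g) : ∃ a : ℝ, g = C a * f := by
  by_cases hg : g = 0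
  · exact ⟨0, by simp [hg]⟩
  have hlf : f.leadingCoeff ≠ 0 := by simpa using hf
  have hlg : g.leadingCoeff ≠ 0 := by simpa using hg
  have ha : g.leadingCoeff / f.leadingCoeff ≠ 0 := div_ne_zero hlg hlf
  refine ⟨g.leadingCoeff / f.leadingCoeff, ?_⟩
  set a := g.leadingCoeff / f.leadingCoeff
  by_contra hne
  have hd := natDegree_eq_of_wronskian_eq_zero hf hg h
  have hsub : g - C a * f ≠ 0 := sub_ne_zero.2 hne
  have hd' := natDegree_eq_of_wronskian_eq_zero hf hsub (by
    simp only [derivative_sub, derivative_C_mul]; linear_combination h)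
  have hdeg : g.degree = (C a * f).degree := by
    rw [degree_C_mul ha, degree_eq_natDegree hg, degree_eq_natDegree hf, hd]
  have hlt := degree_sub_lt_left hdeg hg (by
    rw [leadingCoeff_mul, leadingCoeff_C, div_mul_cancel₀ _ hlf])
  rw [degree_eq_natDegree hsub, degree_eq_natDegree hg, ← hd', hd] at hlt
  exact lt_irrefl _ hlt

/-- The value at `z` of the `i`-th Hasse derivative of `X ^ j`. -/
noncomputable def hasseTerm (z : ℝ) (j i : ℕ) : ℝ := (j.choose i : ℝ) * z ^ (j - i)

/-- The multi-indices `J` with `J k < N k` for all `k`. -/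
def indexBox {m : ℕ} (N : Fin m → ℕ) : Finset (Fin m → ℕ) :=
  Fintype.piFinset fun k => Finset.range (N k)

theorem mem_indexBox {m : ℕ} {N J : Fin m → ℕ} : J ∈ indexBox N ↔ ∀ k, J k < N k := by
  simp [indexBox]

/-- The value at `z` of the Hasse derivative of multi-order `I` of the polynomial
`∑ J ∈ indexBox N, c J * X ^ J`. -/
noncomputable def hasseEval {m : ℕ} (N : Fin m → ℕ) (c : (Fin m → ℕ) → ℝ) (I : Fin m → ℕ)
    (z : Fin m → ℝ) : ℝ :=
  ∑ J ∈ indexBox N, c J * ∏ k, hasseTerm (z k) (J k) (I k)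

theorem hasseTerm_taylor (α z : ℝ) {j N : ℕ} (hj : j < N) (i : ℕ) :
    hasseTerm z j i =
      ∑ l ∈ Finset.range N, hasseTerm α j (i + l) * ((i + l).choose i * (z - α) ^ l) := by
  by_cases hij : i ≤ j
  · have hsub : Finset.range (j - i + 1) ⊆ Finset.range N :=
      Finset.range_subset_range.2 (by omega)
    rw [← Finset.sum_subset hsub]
    · unfold hasseTerm
      have : z ^ (j - i) = ((z - α) + α) ^ (j - i) := by ring
      rw [this, add_pow, Finset.mul_sum]
      refine Finset.sum_congr rfl fun l _ => ?_
      have h := Nat.choose_mul (n := j) (k := i + l) (s := i) (by omega)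
      rw [Nat.add_sub_cancel_left] at h
      have h' : (j.choose (i + l) : ℝ) * (i + l).choose i = j.choose i * (j - i).choose l := by
        exact_mod_cast h
      rw [Nat.sub_add_eq]
      linear_combination -(z - α) ^ l * α ^ (j - i - l) * h'
    · intro l _ hl
      have : j < i + l := by simp at hl; omega
      simp [hasseTerm, Nat.choose_eq_zero_of_lt this]
  · have h0 : j.choose i = 0 := Nat.choose_eq_zero_of_lt (by omega)
    have h1 : ∀ l, j.choose (i + l) = 0 := fun l => Nat.choose_eq_zero_of_lt (by omega)
    simp [hasseTerm, h0, h1]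

theorem hasseEval_taylor {m : ℕ} (N : Fin m → ℕ) (c : (Fin m → ℕ) → ℝ) (I : Fin m → ℕ)
    (α z : Fin m → ℝ) :
    hasseEval N c I z = ∑ l ∈ indexBox N, hasseEval N c (I + l) α *
      ∏ k, (((I k + l k).choose (I k) : ℝ) * (z k - α k) ^ l k) := by
  simp only [hasseEval, Finset.sum_mul]
  rw [Finset.sum_comm]
  refine Finset.sum_congr rfl fun J hJ => ?_
  have : ∀ k, hasseTerm (z k) (J k) (I k) = _ := fun k =>
    hasseTerm_taylor (α k) (z k) (mem_indexBox.1 hJ k) (I k)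
  simp only [this]
  rw [Finset.prod_univ_sum, Finset.mul_sum]
  refine Finset.sum_congr rfl fun l _ => ?_
  rw [Finset.prod_mul_distrib]
  simp only [Pi.add_apply]
  ring

theorem hasseEval_eq_zero_of_le {m : ℕ} {N : Fin m → ℕ} (c : (Fin m → ℕ) → ℝ) {I : Fin m → ℕ}
    (z : Fin m → ℝ) {k : Fin m} (hk : N k ≤ I k) : hasseEval N c I z = 0 := by
  refine Finset.sum_eq_zero fun J hJ => ?_
  have : J k < I k := (mem_indexBox.1 hJ k).trans_le hk
  rw [Finset.prod_eq_zero (Finset.mem_univ k), mul_zero]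
  simp [hasseTerm, Nat.choose_eq_zero_of_lt this]

theorem sum_indexBox_succ {m : ℕ} (N : Fin (m + 1) → ℕ) (F : (Fin (m + 1) → ℕ) → ℝ) :
    ∑ J ∈ indexBox N, F J = ∑ J ∈ indexBox (Fin.tail N), ∑ j ∈ Finset.range (N 0),
      F (Fin.cons j J) := by
  rw [← Finset.sum_product']
  symm
  refine Finset.sum_nbij' (fun a => Fin.cons a.2 a.1) (fun J => (Fin.tail J, J 0)) ?_ ?_ ?_ ?_ ?_
  · intro a ha
    simp only [Finset.mem_product, mem_indexBox, Finset.mem_range] at ha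
    refine mem_indexBox.2 fun k => ?_
    refine Fin.cases ?_ (fun k => ?_) k
    · simpa using ha.2
    · simpa [Fin.tail] using ha.1 k
  · intro J hJ
    simp only [Finset.mem_product, mem_indexBox, Finset.mem_range] at hJ ⊢
    exact ⟨fun k => hJ k.succ, hJ 0⟩
  · intro a _; simp
  · intro J _; simp
  · intro a _; rfl

theorem card_indexBox {m : ℕ} (N : Fin m → ℕ) : (indexBox N).card = ∏ k, N k := by
  simp [indexBox]
open Polynomial in
theorem exists_vector_orthogonal_of_dvd {ι : Type*} [DecidableEq ι] (S : Finset ι) :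
    ∀ (s : Finset ι), s ⊆ S → ∀ f : ι → ℝ[X], (∀ j ∈ S, j ∉ s → f j = 0) → (∃ j ∈ S, f j ≠ 0) →
      ∃ (ψ : ι → ℝ) (w : ℝ[X]), (∃ j ∈ S, ψ j ≠ 0) ∧ w ≠ 0 ∧
        ∀ (x : ℝ) (b : ι → ℝ), w.eval x ≠ 0 →
          (X - C x) ^ s.card ∣ ∑ j ∈ S, C (b j) * f j → ∑ j ∈ S, b j * ψ j = 0 := by
  intro s
  induction s using Finset.strongInduction with
  | H s ih =>
  intro hs f hf ⟨j₀, hj₀, hne⟩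
  have hjs : j₀ ∈ s := by
    by_contra h
    exact hne (hf j₀ hj₀ h)
  by_cases hg : ∃ j ∈ S, f j₀ * derivative (f j) - derivative (f j₀) * f j ≠ 0
  · obtain ⟨ψ, w, hψ, hw, H⟩ := ih (s.erase j₀) (Finset.erase_ssubset hjs)
      ((Finset.erase_subset _ _).trans hs)
      (fun j => f j₀ * derivative (f j) - derivative (f j₀) * f j) (by
        intro j hj hjn
        by_cases hjj : j = j₀
        · subst hjj; ring
        · have : f j = 0 := hf j hj fun h => hjn (Finset.mem_erase.2 ⟨hjj, h⟩)
          simp [this]) hg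
    refine ⟨ψ, w, hψ, hw, fun x b hx hd => H x b hx ?_⟩
    have hcard : (s.erase j₀).card = s.card - 1 := Finset.card_erase_of_mem hjs
    have e : ∑ j ∈ S, C (b j) * (f j₀ * derivative (f j) - derivative (f j₀) * f j)
        = f j₀ * derivative (∑ j ∈ S, C (b j) * f j)
          - derivative (f j₀) * ∑ j ∈ S, C (b j) * f j := by
      simp only [derivative_sum, derivative_C_mul, Finset.mul_sum, ← Finset.sum_sub_distrib]
      exact Finset.sum_congr rfl fun j _ => by ring
    rw [e, hcard]
    exact dvd_sub (Dvd.dvd.mul_left (pow_sub_one_dvd_derivative_of_pow_dvd hd) _)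
      (Dvd.dvd.mul_left ((pow_dvd_pow _ (Nat.sub_le _ _)).trans hd) _)
  · push Not at hg
    have : ∀ j ∈ S, ∃ a : ℝ, f j = C a * f j₀ := fun j hj =>
      exists_eq_C_mul_of_wronskian_eq_zero hne (sub_eq_zero.1 (hg j hj))
    choose! ψ hψ using this
    refine ⟨ψ, f j₀, ⟨j₀, hj₀, ?_⟩, hne, fun x b hx hd => ?_⟩
    · intro h
      have := hψ j₀ hj₀
      rw [h] at this
      simp at this
      exact hne this
    · have e : ∑ j ∈ S, C (b j) * f j = C (∑ j ∈ S, b j * ψ j) * f j₀ := by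
        rw [map_sum, Finset.sum_mul]
        refine Finset.sum_congr rfl fun j hj => ?_
        conv_lhs => rw [hψ j hj]
        rw [C_mul]; ring
      have h1 : (X - C x) ∣ C (∑ j ∈ S, b j * ψ j) * f j₀ := by
        rw [← e]
        exact (dvd_pow_self _ (Finset.card_ne_zero_of_mem hjs)).trans hd
      rw [dvd_iff_isRoot, IsRoot, eval_mul, eval_C] at h1
      exact (mul_eq_zero.1 h1).resolve_right hx

open Polynomial in
theorem X_sub_C_pow_dvd_of_hasseDeriv {F : ℝ[X]} {x : ℝ} {r : ℕ}
    (h : ∀ i < r, (hasseDeriv i F).eval x = 0) : (X - C x) ^ r ∣ F := by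
  rw [X_sub_C_pow_dvd_iff, X_pow_dvd_iff]
  intro i hi
  rw [← h i hi, ← taylor_coeff, taylor_apply]

open Polynomial in
/-- A nonzero polynomial of partial degrees `< N k` has, at every point whose coordinates avoid
a finite set, a nonzero Hasse derivative of order less than `∏ l > k, N l` in the `k`-th
variable. -/
theorem exists_hasseEval_ne_zero : ∀ {m : ℕ} (N : Fin m → ℕ) (c : (Fin m → ℕ) → ℝ),
    (∃ J ∈ indexBox N, c J ≠ 0) → ∃ E : Set ℝ, E.Finite ∧ ∀ z : Fin m → ℝ, (∀ k, z k ∉ E) →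
      ∃ I : Fin m → ℕ, (∀ k, I k < ∏ l ∈ Finset.Ioi k, N l) ∧ hasseEval N c I z ≠ 0 := by
  intro m
  induction m with
  | zero =>
    rintro N c ⟨J, hJ, hc⟩
    refine ⟨∅, Set.finite_empty, fun z _ => ⟨J, fun k => k.elim0, ?_⟩⟩
    have : indexBox N = {J} := by
      ext K; simp [mem_indexBox, Subsingleton.elim K J]
    simpa [hasseEval, this] using hc
  | succ m ih =>
    rintro N c ⟨J₀, hJ₀, hc⟩
    set f : (Fin m → ℕ) → ℝ[X] := fun J =>
      ∑ j ∈ Finset.range (N 0), monomial j (c (Fin.cons j J)) with hf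
    have hcoeff : (f (Fin.tail J₀)).coeff (J₀ 0) = c J₀ := by
      have h0 : J₀ 0 < N 0 := mem_indexBox.1 hJ₀ 0
      simp [hf, coeff_monomial, h0]
    obtain ⟨ψ, w, ⟨J₁, hJ₁, hψ⟩, hw, H⟩ := exists_vector_orthogonal_of_dvd (indexBox (Fin.tail N))
      (indexBox (Fin.tail N)) subset_rfl f (fun j hj hn => absurd hj hn)
      ⟨Fin.tail J₀, mem_indexBox.2 fun k => mem_indexBox.1 hJ₀ k.succ, by
        intro h; rw [h] at hcoeff; exact hc (by simpa using hcoeff.symm)⟩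
    obtain ⟨E, hE, HE⟩ := ih (Fin.tail N) ψ ⟨J₁, hJ₁, hψ⟩
    refine ⟨E ∪ {x | w.IsRoot x}, hE.union (finite_setOfPred_isRoot hw), fun z hz => ?_⟩
    obtain ⟨I, hI, hne⟩ := HE (Fin.tail z) fun k hk => hz k.succ (Or.inl hk)
    have hz0 : w.eval (z 0) ≠ 0 := fun h => hz 0 (Or.inr h)
    by_contra hcon
    push Not at hcon
    refine hne ?_
    have := H (z 0) (fun J => ∏ k, hasseTerm (Fin.tail z k) (J k) (I k)) hz0 ?_
    · rw [← this, hasseEval]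
      exact Finset.sum_congr rfl fun J _ => mul_comm _ _
    refine X_sub_C_pow_dvd_of_hasseDeriv fun i hi => ?_
    have h0 := hcon (Fin.cons i I) (by
      intro k
      refine Fin.cases ?_ (fun k => ?_) k
      · rw [Fin.prod_Ioi_zero]
        simpa [card_indexBox, Fin.tail] using hi
      · rw [Fin.prod_Ioi_succ]
        simpa [Fin.tail] using hI k)
    rw [← h0, hasseEval, sum_indexBox_succ]
    simp only [map_sum, eval_finsetSum]
    refine Finset.sum_congr rfl fun J _ => ?_
    simp only [hf, ← smul_eq_C_mul, map_smul, map_sum, eval_smul, eval_finsetSum,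
      hasseDeriv_monomial, eval_monomial, Finset.smul_sum, smul_eq_mul, Fin.prod_univ_succ,
      Fin.cons_zero, Fin.cons_succ, hasseTerm, Fin.tail]
    refine Finset.sum_congr rfl fun j _ => ?_
    ring

theorem sum_exp_le {N : ℕ} (hN : 40 ≤ N) :
    ∑ i ∈ Finset.range N, Real.exp ((1 / 40 : ℝ) * (19 / 40 - (i : ℝ) / N)) ≤
      (1 - 1 / 8000) * N := by
  have hN0 : (40 : ℝ) ≤ N := by exact_mod_cast hN
  have hterm : ∀ i ∈ Finset.range N, Real.exp ((1 / 40 : ℝ) * (19 / 40 - (i : ℝ) / N)) ≤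
      1 + (1 / 40 : ℝ) * (19 / 40 - (i : ℝ) / N) + (1 / 40) ^ 2 * (21 / 40) ^ 2 := by
    intro i hi
    have hi' : (i : ℝ) < N := by exact_mod_cast Finset.mem_range.1 hi
    have h0 : 0 ≤ (i : ℝ) / N := by positivity
    have h1 : (i : ℝ) / N ≤ 1 := by rw [div_le_one (by linarith)]; exact hi'.le
    have hy : |(1 / 40 : ℝ) * (19 / 40 - (i : ℝ) / N)| ≤ 1 := by
      rw [abs_le]; constructor <;> linarith
    have := (abs_le.1 (Real.abs_exp_sub_one_sub_id_le hy)).2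
    nlinarith
  refine (Finset.sum_le_sum hterm).trans ?_
  have hs : ∑ i ∈ Finset.range N, (i : ℝ) = N * (N - 1) / 2 := by
    clear hterm hN0 hN
    induction N with
    | zero => simp
    | succ n ih => rw [Finset.sum_range_succ, ih]; push_cast; ring
  have hs' : ∑ i ∈ Finset.range N, (i : ℝ) / N = (N - 1) / 2 := by
    rw [← Finset.sum_div, hs]; field_simp
  rw [Finset.sum_add_distrib, Finset.sum_add_distrib, ← Finset.mul_sum, Finset.sum_sub_distrib, hs']
  simp only [Finset.sum_const, Finset.card_range, nsmul_eq_mul]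
  nlinarith

theorem card_filter_indexBox_le {m : ℕ} {N : Fin m → ℕ} (hN : ∀ k, 40 ≤ N k) :
    (((indexBox N).filter fun I => ∑ k, (I k : ℝ) / N k ≤ 19 / 40 * m).card : ℝ) ≤
      (1 - 1 / 8000) ^ m * ∏ k, (N k : ℝ) := by
  have h1 : ∏ k, ∑ i ∈ Finset.range (N k), Real.exp ((1 / 40 : ℝ) * (19 / 40 - (i : ℝ) / N k)) ≤
      (1 - 1 / 8000) ^ m * ∏ k, (N k : ℝ) := by
    calc _ ≤ ∏ k, ((1 - 1 / 8000 : ℝ) * N k) :=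
          Finset.prod_le_prod (fun k _ => Finset.sum_nonneg fun i _ => (Real.exp_pos _).le)
            fun k _ => sum_exp_le (hN k)
      _ = _ := by rw [Finset.prod_mul_distrib]; simp
  refine le_trans ?_ h1
  rw [Finset.prod_univ_sum, Finset.card_eq_sum_ones, Finset.sum_filter]
  push_cast
  refine Finset.sum_le_sum fun I _ => ?_
  rw [← Real.exp_sum]
  split_ifs with h
  · refine Real.one_le_exp ?_
    rw [← Finset.mul_sum, Finset.sum_sub_distrib]
    simp only [Finset.sum_const, Finset.card_univ, Fintype.card_fin, nsmul_eq_mul]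
    nlinarith
  · exact (Real.exp_pos _).le

open IntermediateField in
/-- Existence of an auxiliary polynomial vanishing to high weighted order at `(α, …, α)`. -/
theorem exists_auxiliary {α : ℝ} (hα : IsIntegral ℚ α) {m : ℕ}
    (hm : (Module.finrank ℚ ℚ⟮α⟯ : ℝ) * (1 - 1 / 8000) ^ m < 1) {N : Fin m → ℕ}
    (hN : ∀ k, 40 ≤ N k) :
    ∃ c : (Fin m → ℕ) → ℤ, (∃ J ∈ indexBox N, c J ≠ 0) ∧
      ∀ I : Fin m → ℕ, ∑ k, (I k : ℝ) / N k ≤ 19 / 40 * m →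
        hasseEval N (fun J => (c J : ℝ)) I (fun _ => α) = 0 := by
  classical
  have : FiniteDimensional ℚ ℚ⟮α⟯ := adjoin.finiteDimensional hα
  set low := (indexBox N).filter fun I => ∑ k, (I k : ℝ) / N k ≤ 19 / 40 * m with hlow
  set v : (Fin m → ℕ) → (Fin m → ℕ) → ℚ⟮α⟯ := fun I J =>
    ∏ k, (((J k).choose (I k) : ℚ⟮α⟯) * AdjoinSimple.gen ℚ α ^ (J k - I k)) with hv
  set φ : (indexBox N → ℚ) →ₗ[ℚ] (low → ℚ⟮α⟯) :=
    LinearMap.pi fun I => Fintype.linearCombination ℚ fun J : indexBox N => v I J with hφ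
  have hker : LinearMap.ker φ ≠ ⊥ := by
    refine LinearMap.ker_ne_bot_of_finrank_lt ?_
    rw [Module.finrank_pi_fintype, Module.finrank_fintype_fun_eq_card]
    simp only [Finset.sum_const, Finset.card_univ, Fintype.card_coe, smul_eq_mul, card_indexBox]
    have h1 := card_filter_indexBox_le hN
    have hpos : 0 < ∏ k, (N k : ℝ) := Finset.prod_pos fun k _ => by
      have := hN k; positivity
    have h2 : ((low.card * Module.finrank ℚ ℚ⟮α⟯ : ℕ) : ℝ) < ((∏ k, N k : ℕ) : ℝ) := by
      push_cast
      calc (low.card : ℝ) * Module.finrank ℚ ℚ⟮α⟯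
          ≤ ((1 - 1 / 8000) ^ m * ∏ k, (N k : ℝ)) * Module.finrank ℚ ℚ⟮α⟯ := by gcongr
        _ = (Module.finrank ℚ ℚ⟮α⟯ * (1 - 1 / 8000) ^ m) * ∏ k, (N k : ℝ) := by ring
        _ < 1 * ∏ k, (N k : ℝ) := by gcongr
        _ = _ := one_mul _
    exact_mod_cast h2
  obtain ⟨c, hc, hc0⟩ := (Submodule.ne_bot_iff _).1 hker
  obtain ⟨b, hb⟩ := IsLocalization.exist_integer_multiples (nonZeroDivisors ℤ)
    (Finset.univ : Finset (indexBox N)) c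
  choose! e he using fun J => hb J (Finset.mem_univ J)
  have hbne : ((b : ℤ) : ℝ) ≠ 0 := by exact_mod_cast nonZeroDivisors.ne_zero b.2
  have he' : ∀ J, (e J : ℝ) = (b : ℤ) * (c J : ℝ) := by
    intro J
    have := he J
    simp only [algebraMap_int_eq, eq_intCast, zsmul_eq_mul] at this
    exact_mod_cast this
  refine ⟨fun J => if h : J ∈ indexBox N then e ⟨J, h⟩ else 0, ?_, fun I hI => ?_⟩
  · obtain ⟨J, hJ⟩ : ∃ J, c J ≠ 0 := by
      by_contra! h; exact hc0 (funext h)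
    refine ⟨J, J.2, ?_⟩
    beta_reduce
    rw [dif_pos J.2]
    have : (e J : ℝ) ≠ 0 := by
      rw [he']; exact mul_ne_zero hbne (by exact_mod_cast hJ)
    exact_mod_cast this
  · by_cases hIb : I ∈ indexBox N
    · have h1 := congrFun (LinearMap.mem_ker.1 hc) ⟨I, Finset.mem_filter.2 ⟨hIb, hI⟩⟩
      simp only [hφ, LinearMap.pi_apply, Fintype.linearCombination_apply, Pi.zero_apply] at h1
      have h2 := congrArg (algebraMap ℚ⟮α⟯ ℝ) h1
      simp only [map_sum, map_zero, hv, Algebra.smul_def, map_mul, map_prod, map_natCast, map_pow,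
        AdjoinSimple.algebraMap_gen] at h2
      rw [hasseEval, ← Finset.sum_coe_sort]
      have h3 : ∀ J : indexBox N, ((if h : (J : Fin m → ℕ) ∈ indexBox N then e ⟨J, h⟩ else 0 : ℤ) : ℝ)
          = (b : ℤ) * (c J : ℝ) := by
        intro J; rw [dif_pos J.2, he']
      simp only [h3, hasseTerm, mul_assoc]
      rw [← Finset.mul_sum]
      refine mul_eq_zero_of_right _ ?_
      rw [← h2]
      simp
    · obtain ⟨k, hk⟩ : ∃ k, N k ≤ I k := by
        by_contra! h; exact hIb (mem_indexBox.2 h)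
      exact hasseEval_eq_zero_of_le _ _ hk

/-- Liouville-type lower bound at a rational point. -/
theorem one_le_abs_hasseEval_mul {m : ℕ} {N : Fin m → ℕ} (c : (Fin m → ℕ) → ℤ) (I : Fin m → ℕ)
    (P Q : Fin m → ℤ) (hQ : ∀ k, 0 < Q k)
    (h : hasseEval N (fun J => (c J : ℝ)) I (fun k => (P k : ℝ) / Q k) ≠ 0) :
    1 ≤ |hasseEval N (fun J => (c J : ℝ)) I (fun k => (P k : ℝ) / Q k)| *
      ∏ k, (Q k : ℝ) ^ (N k - 1) := by
  have hQ' : ∀ k, (0 : ℝ) < Q k := fun k => by exact_mod_cast hQ k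
  have hpos : 0 < ∏ k, (Q k : ℝ) ^ (N k - 1) := Finset.prod_pos fun k _ => pow_pos (hQ' k) _
  have hint : hasseEval N (fun J => (c J : ℝ)) I (fun k => (P k : ℝ) / Q k) *
      ∏ k, (Q k : ℝ) ^ (N k - 1) = ((∑ J ∈ indexBox N, c J * ∏ k, (((J k).choose (I k) : ℤ) *
        P k ^ (J k - I k) * Q k ^ (N k - 1 - (J k - I k))) : ℤ) : ℝ) := by
    push_cast
    rw [hasseEval, Finset.sum_mul]
    refine Finset.sum_congr rfl fun J hJ => ?_
    rw [mul_assoc, ← Finset.prod_mul_distrib]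
    congr 1
    refine Finset.prod_congr rfl fun k _ => ?_
    have hlt := mem_indexBox.1 hJ k
    have : (Q k : ℝ) ^ (N k - 1) = Q k ^ (J k - I k) * Q k ^ (N k - 1 - (J k - I k)) := by
      rw [← pow_add]; congr 1; omega
    rw [this, hasseTerm, div_pow]
    have := (hQ' k).ne'
    field_simp
  rw [← abs_of_pos hpos, ← abs_mul, hint]
  have hne := mul_ne_zero h hpos.ne'
  rw [hint] at hne
  exact_mod_cast Int.one_le_abs (by exact_mod_cast hne)

open Filter in
theorem exists_balanced_index {h : ℕ → ℝ} (hpos : ∀ n, 0 < h n) (ht : Tendsto h atTop atTop)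
    {B : ℝ} (hB : ∀ n, h (n + 1) ≤ B * h n) {p : ℕ → Prop} (hp : ∃ᶠ L in atTop, p L)
    {A : ℕ} (hA : 1 ≤ A) :
    ∃ D : ℕ, A ≤ D ∧ ∃ᶠ L : ℕ in atTop, p L ∧ ∃ n, (D : ℝ) * h n ≤ L ∧ (L : ℝ) ≤ (D + 1) * h n := by
  have hA' : (1 : ℝ) ≤ A := by exact_mod_cast hA
  have hev : ∀ᶠ L : ℕ in atTop, A * h 0 ≤ L := tendsto_natCast_atTop_atTop.eventually_ge_atTop _
  by_contra! hcon
  have hall : ∀ᶠ L : ℕ in atTop, ∀ D ∈ Finset.Icc A ⌊A * B⌋₊,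
      ¬ (p L ∧ ∃ n, (D : ℝ) * h n ≤ L ∧ (L : ℝ) ≤ (D + 1) * h n) := by
    rw [Filter.eventually_all_finset]
    intro D hD
    exact not_frequently.1 (by simpa using hcon D (Finset.mem_Icc.1 hD).1)
  obtain ⟨L, hpL, hL0, hL⟩ := (hp.and_eventually (hev.and hall)).exists
  have hex : ∃ n, (L : ℝ) < A * h (n + 1) := by
    obtain ⟨n, hn⟩ := ((ht.comp (tendsto_add_atTop_nat 1)).eventually_gt_atTop (L : ℝ)).exists
    refine ⟨n, hn.trans_le ?_⟩
    exact le_mul_of_one_le_left (hpos _).le hA'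
  classical
  have hlt := Nat.find_spec hex
  set n := Nat.find hex with hn
  have hle : A * h n ≤ L := by
    rcases Nat.eq_zero_or_pos n with h0 | h0
    · rw [h0]; exact hL0
    · have := Nat.find_min hex (m := n - 1) (by omega)
      rw [Nat.sub_add_cancel h0] at this
      exact not_lt.1 this
  have hq0 : 0 ≤ (L : ℝ) / h n := div_nonneg (Nat.cast_nonneg _) (hpos n).le
  have hqA : (A : ℝ) ≤ L / h n := by rwa [le_div_iff₀ (hpos n)]
  have hqB : (L : ℝ) / h n ≤ A * B := by
    rw [div_le_iff₀ (hpos n)]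
    nlinarith [hB n, hpos n]
  refine hL ⌊(L : ℝ) / h n⌋₊ (Finset.mem_Icc.2 ⟨Nat.le_floor hqA, Nat.floor_le_floor hqB⟩)
    ⟨hpL, n, ?_, ?_⟩
  · rw [← le_div_iff₀ (hpos n)]; exact Nat.floor_le hq0
  · rw [← div_le_iff₀ (hpos n)]; exact (Nat.lt_floor_add_one _).le

open Filter in
theorem exists_balanced_indices {h : ℕ → ℝ} (hpos : ∀ n, 0 < h n) (ht : Tendsto h atTop atTop)
    {B : ℝ} (hB : ∀ n, h (n + 1) ≤ B * h n) (m : ℕ) :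
    ∃ N : Fin m → ℕ, (∀ k, 40 * ∏ l ∈ Finset.Ioi k, N l ≤ N k) ∧ (∀ k, 40 ≤ N k) ∧
      ∃ᶠ L : ℕ in atTop, ∃ ν : Fin m → ℕ, ∀ k,
        ((N k - 1 : ℕ) : ℝ) * h (ν k) ≤ L ∧ (L : ℝ) ≤ N k * h (ν k) := by
  induction m with
  | zero => exact ⟨Fin.elim0, fun k => k.elim0, fun k => k.elim0,
      Frequently.of_forall fun L => ⟨Fin.elim0, fun k => k.elim0⟩⟩
  | succ m ih =>
    obtain ⟨N, hN, hN40, hf⟩ := ih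
    obtain ⟨D, hD, hfD⟩ := exists_balanced_index hpos ht hB hf (A := 40 * ∏ l, N l + 40) (by omega)
    refine ⟨Fin.cons (D + 1) N, fun k => ?_, fun k => ?_, hfD.mono ?_⟩
    · refine Fin.cases ?_ (fun k => ?_) k
      · simp only [Fin.prod_Ioi_zero, Fin.cons_succ, Fin.cons_zero]; omega
      · simpa [Fin.prod_Ioi_succ] using hN k
    · refine Fin.cases ?_ (fun k => ?_) k
      · simp only [Fin.cons_zero]; omega
      · simpa using hN40 k
    · rintro L ⟨⟨ν, hν⟩, n, hn⟩
      refine ⟨Fin.cons n ν, fun k => ?_⟩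
      refine Fin.cases ?_ (fun k => ?_) k
      · simpa using hn
      · simpa using hν k

open Filter Topology in
/-- A case of Roth's theorem: a number with rational approximations of exponent `5 / 2` whose
denominators grow at most polynomially from one to the next is transcendental. -/
theorem transcendental_of_dense_approximations {α : ℝ} {P Q : ℕ → ℤ} (hQ : ∀ n, 2 ≤ Q n)
    {B : ℝ} (hB : ∀ n, Real.log (Q (n + 1)) ≤ B * Real.log (Q n))
    (hQt : Tendsto (fun n => Real.log (Q n)) atTop atTop) (hne : ∀ n, α ≠ P n / Q n)
    (happ : ∀ n, |α - P n / Q n| ≤ Real.exp (-(5 / 2) * Real.log (Q n))) :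
    Transcendental ℚ α := by
  intro halg
  have hint : IsIntegral ℚ α := halg.isIntegral
  set h : ℕ → ℝ := fun n => Real.log (Q n) with hh
  have hQ1 : ∀ n, (1 : ℝ) < Q n := fun n => by
    have := hQ n
    exact_mod_cast (by omega : 1 < Q n)
  have hpos : ∀ n, 0 < h n := fun n => Real.log_pos (hQ1 n)
  have hexp : ∀ n, Real.exp (h n) = Q n := fun n => Real.exp_log (by linarith [hQ1 n])
  obtain ⟨m, hm, hm1⟩ : ∃ m : ℕ,
      (Module.finrank ℚ (IntermediateField.adjoin ℚ {α}) : ℝ) * (1 - 1 / 8000) ^ m < 1 ∧ 1 ≤ m := by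
    have ht : Tendsto (fun m : ℕ => (Module.finrank ℚ (IntermediateField.adjoin ℚ {α}) : ℝ) *
        (1 - 1 / 8000) ^ m) atTop (𝓝 (_ * 0)) :=
      (tendsto_pow_atTop_nhds_zero_of_lt_one (by norm_num) (by norm_num)).const_mul _
    rw [mul_zero] at ht
    exact ((ht.eventually (gt_mem_nhds one_pos)).and (eventually_ge_atTop 1)).exists
  obtain ⟨N, hN, hN40, hfreq⟩ := exists_balanced_indices hpos hQt hB m
  have hNpos : ∀ k, (0 : ℝ) < N k := fun k => by
    have := hN40 k
    exact_mod_cast (by omega : 0 < N k)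
  obtain ⟨c, ⟨J, hJ, hcJ⟩, hvan⟩ := exists_auxiliary hint hm hN40
  obtain ⟨E, hE, hEz⟩ := exists_hasseEval_ne_zero N (fun J => (c J : ℝ))
    ⟨J, hJ, by exact_mod_cast hcJ⟩
  have hlim : Tendsto (fun n => (P n : ℝ) / Q n) atTop (𝓝 α) := by
    rw [tendsto_iff_dist_tendsto_zero]
    have hz : Tendsto (fun n => Real.exp (-(5 / 2) * h n)) atTop (𝓝 0) :=
      Real.tendsto_exp_atBot.comp (hQt.const_mul_atTop_of_neg (by norm_num))
    refine squeeze_zero (fun _ => dist_nonneg) (fun n => ?_) hz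
    rw [dist_comm]; exact happ n
  have hav : ∀ᶠ n in atTop, (P n : ℝ) / Q n ∉ E := by
    have hopen : IsOpen (E \ {α})ᶜ := (hE.subset Set.sdiff_subset).isClosed.isOpen_compl
    filter_upwards [hlim.eventually (hopen.mem_nhds (by simp))] with n hn hnE
    exact hn ⟨hnE, fun h => hne n h.symm⟩
  obtain ⟨n₀, hn₀⟩ := eventually_atTop.1 hav
  have hlarge : ∀ᶠ L : ℕ in atTop, ∀ k, ∀ n < n₀, (N k : ℝ) * h n < L := by
    rw [eventually_all]
    intro k
    have := (Filter.eventually_all_finset (Finset.range n₀)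
      (p := fun n (L : ℕ) => (N k : ℝ) * h n < L)).2
      fun n _ => tendsto_natCast_atTop_atTop.eventually_gt_atTop _
    simpa using this
  set box := indexBox fun k => ∏ l ∈ Finset.Ioi k, N l
  set coef : (Fin m → ℕ) → (Fin m → ℕ) → ℝ := fun I l =>
    |hasseEval N (fun J => (c J : ℝ)) (I + l) (fun _ => α)| *
      ∏ k, ((I k + l k).choose (I k) : ℝ) with hcoef
  have hcoef0 : ∀ I l, 0 ≤ coef I l := fun I l => by positivity
  set K := ∑ I ∈ box, ∑ l ∈ indexBox N, coef I l with hK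
  have hK0 : ∀ I ∈ box, ∑ l ∈ indexBox N, coef I l ≤ K := fun I hI =>
    Finset.single_le_sum (f := fun I => ∑ l ∈ indexBox N, coef I l)
      (fun I _ => Finset.sum_nonneg fun l _ => hcoef0 I l) hI
  have hKlt : ∀ᶠ L : ℕ in atTop, K < Real.exp (1 / 8 * m * L) := by
    have hm0 : (0 : ℝ) < 1 / 8 * m := by
      have : (1 : ℝ) ≤ m := by exact_mod_cast hm1
      linarith
    exact (Real.tendsto_exp_atTop.comp
      (tendsto_natCast_atTop_atTop.const_mul_atTop hm0)).eventually_gt_atTop K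
  obtain ⟨L, ⟨ν, hν⟩, hL, hLK⟩ := (hfreq.and_eventually (hlarge.and hKlt)).exists
  obtain ⟨I, hI, hIne⟩ := hEz (fun k => (P (ν k) : ℝ) / Q (ν k)) fun k => by
    refine hn₀ _ (not_lt.1 fun hlt => ?_)
    exact absurd (hL k _ hlt) (not_lt.2 (hν k).2)
  have hlower := one_le_abs_hasseEval_mul c I (fun k => P (ν k)) (fun k => Q (ν k))
    (fun k => by have := hQ (ν k); omega) hIne
  have hden : ∏ k, (Q (ν k) : ℝ) ^ (N k - 1) ≤ Real.exp (m * L) := by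
    calc _ ≤ ∏ _k : Fin m, Real.exp L := by
          refine Finset.prod_le_prod (fun k _ => by have := hQ1 (ν k); positivity) fun k _ => ?_
          rw [← hexp, ← Real.exp_nat_mul]
          exact Real.exp_le_exp.2 (hν k).1
      _ = _ := by rw [Finset.prod_const, ← Real.exp_nat_mul]; simp
  have hupper : |hasseEval N (fun J => (c J : ℝ)) I (fun k => (P (ν k) : ℝ) / Q (ν k))| ≤
      K * Real.exp (-(9 / 8) * m * L) := by
    rw [hasseEval_taylor N _ I (fun _ => α)]
    refine (Finset.abs_sum_le_sum_abs _ _).trans ?_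
    refine le_trans ?_ (mul_le_mul_of_nonneg_right (hK0 I (mem_indexBox.2 hI)) (Real.exp_pos _).le)
    rw [Finset.sum_mul]
    refine Finset.sum_le_sum fun l _ => ?_
    by_cases hw : ∑ k, ((I + l) k : ℝ) / N k ≤ 19 / 40 * m
    · rw [hvan _ hw, zero_mul, abs_zero]
      exact mul_nonneg (hcoef0 I l) (Real.exp_pos _).le
    rw [abs_mul, Finset.prod_mul_distrib, abs_mul, ← mul_assoc, hcoef]
    have hch : |∏ k, ((I k + l k).choose (I k) : ℝ)| = ∏ k, ((I k + l k).choose (I k) : ℝ) :=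
      abs_of_nonneg (by positivity)
    rw [hch]
    refine mul_le_mul_of_nonneg_left ?_ (hcoef0 I l)
    rw [Finset.abs_prod]
    have hIk : ∀ k, (I k : ℝ) / N k ≤ 1 / 40 := fun k => by
      rw [div_le_iff₀ (hNpos k)]
      have h1 : 40 * I k ≤ N k := (Nat.mul_le_mul_left 40 (hI k).le).trans (hN k)
      have h2 : (40 : ℝ) * I k ≤ N k := by exact_mod_cast h1
      linarith
    have hsumI : ∑ k, (I k : ℝ) / N k ≤ 1 / 40 * m := by
      calc _ ≤ ∑ _k : Fin m, (1 / 40 : ℝ) := Finset.sum_le_sum fun k _ => hIk k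
        _ = _ := by simp; ring
    have hsuml : 9 / 20 * (m : ℝ) ≤ ∑ k, (l k : ℝ) / N k := by
      have h1 : ∑ k, ((I + l) k : ℝ) / N k = ∑ k, (I k : ℝ) / N k + ∑ k, (l k : ℝ) / N k := by
        rw [← Finset.sum_add_distrib]
        refine Finset.sum_congr rfl fun k _ => ?_
        rw [Pi.add_apply]; push_cast; ring
      linarith
    calc ∏ k, |((P (ν k) : ℝ) / Q (ν k) - α) ^ l k|
        ≤ ∏ k, Real.exp (-(5 / 2) * L * ((l k : ℝ) / N k)) := by
          refine Finset.prod_le_prod (fun k _ => abs_nonneg _) fun k _ => ?_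
          rw [abs_pow, abs_sub_comm]
          refine (pow_le_pow_left₀ (abs_nonneg _) (happ (ν k)) _).trans ?_
          rw [← Real.exp_nat_mul]
          refine Real.exp_le_exp.2 ?_
          have h1 : (L : ℝ) * ((l k : ℝ) / N k) ≤ l k * h (ν k) := by
            rw [mul_div_assoc', div_le_iff₀ (hNpos k)]
            have := mul_le_mul_of_nonneg_right (hν k).2 (Nat.cast_nonneg (α := ℝ) (l k))
            linarith
          change (l k : ℝ) * (-(5 / 2) * h (ν k)) ≤ _
          linarith
      _ = Real.exp (-(5 / 2) * L * ∑ k, (l k : ℝ) / N k) := by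
          rw [← Real.exp_sum, Finset.mul_sum]
      _ ≤ Real.exp (-(9 / 8) * m * L) := by
          refine Real.exp_le_exp.2 ?_
          have := mul_le_mul_of_nonneg_left hsuml (Nat.cast_nonneg (α := ℝ) L)
          linarith
  have hfin : (1 : ℝ) ≤ K * Real.exp (-(1 / 8 * m * L)) := by
    calc (1 : ℝ) ≤ _ := hlower
      _ ≤ (K * Real.exp (-(9 / 8) * m * L)) * Real.exp (m * L) := by
          refine mul_le_mul hupper hden ?_ ((abs_nonneg _).trans hupper)
          exact Finset.prod_nonneg fun k _ => pow_nonneg (by linarith [hQ1 (ν k)]) _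
      _ = _ := by rw [mul_assoc, ← Real.exp_add]; congr 2; ring
  rw [Real.exp_neg, ← div_eq_mul_inv, le_div_iff₀ (Real.exp_pos _)] at hfin
  linarith

/-- Rational approximations `P n / Q n` with error at most `Q n ^ (-5 / 2)` and `2 / Q (n + 1)`
force transcendence. -/
theorem transcendental_of_approximations {α : ℝ} {P Q : ℕ → ℤ} (hQ : ∀ n, 2 ≤ Q n)
    (hQt : Filter.Tendsto (fun n => Real.log (Q n)) Filter.atTop Filter.atTop)
    (hne : ∀ n, α ≠ P n / Q n)
    (happ : ∀ n, |α - P n / Q n| ≤ Real.exp (-(5 / 2) * Real.log (Q n)))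
    (hnext : ∀ n, |α - P n / Q n| ≤ 2 / Q (n + 1)) : Transcendental ℚ α := by
  by_cases hB : ∃ B : ℝ, ∀ n, Real.log (Q (n + 1)) ≤ B * Real.log (Q n)
  · obtain ⟨B, hB⟩ := hB
    exact transcendental_of_dense_approximations hQ hB hQt hne happ
  · push Not at hB
    have hL : Liouville α := by
      intro k
      obtain ⟨n, hn⟩ := hB (k + 1)
      have hQn : (2 : ℝ) ≤ Q n := by exact_mod_cast hQ n
      have hQn' : (2 : ℝ) ≤ Q (n + 1) := by exact_mod_cast hQ (n + 1)
      refine ⟨P n, Q n, by have := hQ n; omega, hne n, (hnext n).trans_lt ?_⟩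
      have h1 : (Q n : ℝ) ^ (k + 1) < Q (n + 1) := by
        rw [← Real.log_lt_log_iff (by positivity) (by positivity), Real.log_pow]
        exact_mod_cast hn
      rw [div_lt_div_iff₀ (by positivity) (by positivity), one_mul]
      refine lt_of_le_of_lt ?_ h1
      rw [pow_succ, mul_comm]
      gcongr
    intro halg
    exact hL.transcendental ((IsFractionRing.isAlgebraic_iff ℤ ℚ ℝ).2 halg)

open Filter Topology in
theorem eventually_mul_add_lt_of_recurrence {h : ℕ → ℝ} {l : ℝ} (hl : l ^ 2 = 3 * l - 1)
    (hl2 : 5 / 2 < l) (h0 : 0 ≤ h 0) (h1 : 2 * h 0 ≤ h 1)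
    (hrec : ∀ n, 3 * h (n + 1) - h n ≤ h (n + 2)) (ht : Tendsto h atTop atTop) {μ : ℝ}
    (hμ : μ < l) (C : ℝ) : ∀ᶠ n in atTop, μ * h n + C < h (n + 1) := by
  have hl3 : l < 3 := by nlinarith
  have hgrow : ∀ n, 0 ≤ h n ∧ (l - (1 / 2) ^ n) * h n ≤ h (n + 1) := by
    intro n
    induction n with
    | zero => exact ⟨h0, by norm_num; nlinarith⟩
    | succ n ih =>
      obtain ⟨hn, hs⟩ := ih
      set c : ℝ := (1 / 2) ^ n with hc
      have hc0 : 0 < c := by positivity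
      have hc1 : c ≤ 1 := pow_le_one₀ (by norm_num) (by norm_num)
      have hn1 : 0 ≤ h (n + 1) := le_trans (mul_nonneg (by linarith) hn) hs
      refine ⟨hn1, ?_⟩
      have hr := hrec n
      rw [pow_succ, ← hc]
      have hpos : 0 < l - c := by linarith
      have hle : h n ≤ h (n + 1) / (l - c) := by rw [le_div_iff₀ hpos]; linarith
      have hinv : h (n + 1) / (l - c) ≤ (3 - l + c / 2) * h (n + 1) := by
        rw [div_le_iff₀ hpos]
        have : 1 ≤ (3 - l + c / 2) * (l - c) := by nlinarith
        nlinarith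
      change _ ≤ h (n + 2)
      linarith
  have hp : Tendsto (fun n : ℕ => (1 / 2 : ℝ) ^ n) atTop (𝓝 0) :=
    tendsto_pow_atTop_nhds_zero_of_lt_one (by norm_num) (by norm_num)
  have hδ : 0 < (l - μ) / 2 := by linarith
  filter_upwards [hp.eventually (gt_mem_nhds hδ), ht.eventually_gt_atTop (C / ((l - μ) / 2))]
    with n hn hC
  rw [div_lt_iff₀ hδ] at hC
  have := hgrow n
  nlinarith

/-- **Corollary 3.2 (Engel case).**  The number `α = p/q + ∑_{j≥2} 1/x_j` of Theorem 2.1 is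
transcendental, and its irrationality exponent is at least `(3 + √5)/2`: for every
`μ < (3 + √5)/2` there are infinitely many rationals `P/Q` with `0 < |α - P/Q| < 1/Q^μ`. -/
theorem engel_modified_transcendental
    (k : ℕ) (a : ℕ → ℤ) (ha : ∀ j, 1 ≤ j → j ≤ 2 * k → 1 ≤ a j)
    (pc qc : ℕ → ℤ)
    (hpc0 : pc 0 = 0) (hpc1 : pc 1 = 1) (hqc0 : qc 0 = 1) (hqc1 : qc 1 = 0)
    (hpc : ∀ n, pc (n + 2) = a n * pc (n + 1) + pc n)
    (hqc : ∀ n, qc (n + 2) = a n * qc (n + 1) + qc n)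
    (p q : ℤ) (hq : 1 ≤ q) (hcop : Int.gcd p q = 1)
    (hp : p = pc (2 * k + 2)) (hqv : q = qc (2 * k + 2))
    (m : ℤ) (hm : 0 ≤ m)
    (u x y : ℕ → ℤ) (hu : ∀ n, 1 ≤ n → 1 ≤ u n)
    (hx1 : x 1 = q) (hy0 : y 0 = m * q + qc (2 * k + 1) + 1)
    (hrec : ∀ j, 1 ≤ j → y j = y (j - 1) * (1 + u j * x j) ∧ x (j + 1) = x j * y j)
    (α : ℝ) (hα : α = (p : ℝ) / (q : ℝ) + ∑' j : ℕ, (1 : ℝ) / (x (j + 2) : ℝ)) :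
    Transcendental ℚ α ∧
      ∀ μ : ℝ, μ < (3 + Real.sqrt 5) / 2 → (approxSet α μ).Infinite := by
  have hqc_nonneg : ∀ n, n ≤ 2 * k → 0 ≤ qc (n + 1) ∧ 0 ≤ qc (n + 2) := by
    intro n
    induction n with
    | zero => intro _; rw [hqc 0, zero_add, hqc1, hqc0]; norm_num
    | succ n ih =>
      intro hn
      obtain ⟨h1, h2⟩ := ih (by omega)
      refine ⟨h2, ?_⟩
      rw [hqc (n + 1)]
      have := ha (n + 1) (by omega) hn
      positivity
  have hy0' : 1 ≤ y 0 := by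
    have := (hqc_nonneg (2 * k) le_rfl).1
    have : 0 ≤ m * q := mul_nonneg hm (by omega)
    omega
  have hyrec : ∀ n, y (n + 1) = y n * (1 + u (n + 1) * x (n + 1)) := fun n =>
    (hrec (n + 1) (by omega)).1
  have hxrec : ∀ n, x (n + 2) = x (n + 1) * y (n + 1) := fun n => (hrec (n + 1) (by omega)).2
  have hxy : ∀ n, 1 ≤ x (n + 1) ∧ 1 ≤ y n ∧ 1 + x (n + 1) ≤ y (n + 1) := by
    have hstep : ∀ n, 1 ≤ x (n + 1) → 1 ≤ y n → 1 + x (n + 1) ≤ y (n + 1) := by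
      intro n h1 h2
      have h3 := hu (n + 1) (by omega)
      have h4 : x (n + 1) ≤ u (n + 1) * x (n + 1) := le_mul_of_one_le_left (by omega) h3
      rw [hyrec]
      exact (by linarith : 1 + x (n + 1) ≤ 1 + u (n + 1) * x (n + 1)).trans
        (le_mul_of_one_le_left (by linarith) h2)
    intro n
    induction n with
    | zero =>
      have h : 1 ≤ x (0 + 1) := by rw [zero_add, hx1]; exact hq
      exact ⟨h, hy0', hstep 0 h hy0'⟩
    | succ n ih =>
      obtain ⟨h1, h2, h3⟩ := ih
      have h4 : 1 ≤ y (n + 1) := by omega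
      have h5 : 1 ≤ x (n + 1 + 1) := by
        rw [hxrec]; exact one_le_mul_of_one_le_of_one_le h1 h4
      exact ⟨h5, h4, hstep _ h5 h4⟩
  have hdouble : ∀ n, 2 * x (n + 1) ≤ x (n + 2) := by
    intro n
    obtain ⟨h1, _, h3⟩ := hxy n
    rw [hxrec, mul_comm]
    exact mul_le_mul_of_nonneg_left (by omega) (by omega)
  have hcube : ∀ n, x (n + 2) ^ 3 ≤ x (n + 3) * x (n + 1) := by
    intro n
    have h1 := hu (n + 2) (by omega)
    have h2 := (hxy (n + 1)).1
    have e : x (n + 3) * x (n + 1) = x (n + 2) ^ 2 * (1 + u (n + 2) * x (n + 2)) := by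
      have e1 := hxrec (n + 1)
      have e2 := hyrec (n + 1)
      have e3 := hxrec n
      simp only [Nat.add_assoc, Nat.reduceAdd] at e1 e2
      rw [e1, e2, sq]
      nth_rewrite 3 [e3]
      ring
    rw [e, pow_succ]
    refine mul_le_mul_of_nonneg_left ?_ (by positivity)
    nlinarith
  have hxR : ∀ n, (1 : ℝ) ≤ x (n + 1) := fun n => by exact_mod_cast (hxy n).1
  have hxpos : ∀ n, (0 : ℝ) < x (n + 1) := fun n => by linarith [hxR n]
  set h : ℕ → ℝ := fun n => Real.log (x (n + 1)) with hh
  have hexp : ∀ n, Real.exp (h n) = x (n + 1) := fun n => Real.exp_log (hxpos n)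
  have h0 : 0 ≤ h 0 := Real.log_nonneg (hxR 0)
  have h1 : 2 * h 0 ≤ h 1 := by
    have : (x (0 + 1) : ℝ) ^ 2 ≤ x (1 + 1) := by
      have : x (0 + 1) ^ 2 ≤ x (0 + 2) := by
        obtain ⟨h1, _, h3⟩ := hxy 0
        rw [hxrec, sq]
        exact mul_le_mul_of_nonneg_left (by omega) (by omega)
      exact_mod_cast this
    have := Real.log_le_log (pow_pos (hxpos 0) 2) this
    rw [Real.log_pow] at this
    exact_mod_cast this
  have hrec' : ∀ n, 3 * h (n + 1) - h n ≤ h (n + 2) := by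
    intro n
    have hc : (x (n + 1 + 1) : ℝ) ^ 3 ≤ x (n + 2 + 1) * x (n + 1) := by exact_mod_cast hcube n
    have := Real.log_le_log (pow_pos (hxpos (n + 1)) 3) hc
    rw [Real.log_mul (hxpos _).ne' (hxpos _).ne', Real.log_pow] at this
    push_cast at this
    simp only [hh]
    linarith
  have hgeom : ∀ n i, (2 : ℝ) ^ i * x (n + 1) ≤ x (i + n + 1) := by
    intro n i
    induction i with
    | zero => simp
    | succ i ih =>
      have : (2 : ℝ) * x (i + n + 1) ≤ x (i + n + 2) := by exact_mod_cast hdouble (i + n)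
      rw [show i + 1 + n + 1 = i + n + 2 by ring, pow_succ]
      linarith
  have hxt : Filter.Tendsto (fun n => (x (n + 1) : ℝ)) Filter.atTop Filter.atTop := by
    refine Filter.tendsto_atTop_mono (fun n => ?_) (tendsto_pow_atTop_atTop_of_one_lt one_lt_two)
    have h1 := hgeom 0 n
    have h2 : (0 : ℝ) < 2 ^ n := by positivity
    have h3 := hxR 0
    rw [add_zero] at h1
    nlinarith
  have ht : Filter.Tendsto h Filter.atTop Filter.atTop := Real.tendsto_log_atTop.comp hxt
  set P : ℕ → ℤ := fun n => Nat.rec p (fun i P => P * y (i + 1) + 1) n with hP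
  have hPS : ∀ n, (P n : ℝ) / x (n + 1) = p / q + ∑ j ∈ Finset.range n, 1 / (x (j + 2) : ℝ) := by
    intro n
    induction n with
    | zero => simp [hP, hx1]
    | succ n ih =>
      rw [Finset.sum_range_succ, ← add_assoc, ← ih]
      have e : (x (n + 2) : ℝ) = x (n + 1) * y (n + 1) := by exact_mod_cast hxrec n
      have hy : (y (n + 1) : ℝ) ≠ 0 := by
        have := (hxy (n + 1)).2.1
        exact_mod_cast (by omega : y (n + 1) ≠ 0)
      have hx := (hxpos n).ne'
      have hPn : (P (n + 1) : ℝ) = P n * y (n + 1) + 1 := by simp [hP]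
      rw [hPn, show n + 1 + 1 = n + 2 by ring, e]
      field_simp
  have htail : ∀ n i, 1 / (x (i + n + 2) : ℝ) ≤ 1 / x (n + 2) * (1 / 2) ^ i := by
    intro n i
    have h1 := hgeom (n + 1) i
    have h2 := hxpos (n + 1)
    rw [one_div_pow, one_div_mul_one_div_rev, one_div_le_one_div (hxpos _) (by positivity)]
    exact h1
  have hgs : ∀ n, HasSum (fun i => 1 / (x (n + 2) : ℝ) * (1 / 2 : ℝ) ^ i)
      (1 / (x (n + 2) : ℝ) * 2) :=
    fun n => hasSum_geometric_two.mul_left _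
  have hsum : Summable fun j => 1 / (x (j + 2) : ℝ) :=
    Summable.of_nonneg_of_le (fun j => (one_div_pos.2 (hxpos _)).le) (fun j => htail 0 j)
      (hgs 0).summable
  have hdiff : ∀ n, α - P n / x (n + 1) = ∑' i, 1 / (x (i + n + 2) : ℝ) := by
    intro n
    rw [hα, hPS, ← hsum.sum_add_tsum_nat_add n]
    ring
  have hsumn : ∀ n, Summable fun i => 1 / (x (i + n + 2) : ℝ) := fun n =>
    (summable_nat_add_iff n).2 hsum
  have hdpos : ∀ n, 0 < α - P n / x (n + 1) := fun n => by
    rw [hdiff]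
    exact (hsumn n).tsum_pos (fun i => (one_div_pos.2 (hxpos _)).le) 0 (one_div_pos.2 (hxpos _))
  have hdle : ∀ n, α - P n / x (n + 1) ≤ 2 / x (n + 2) := fun n => by
    rw [hdiff]
    refine ((hsumn n).tsum_le_tsum (htail n) (hgs n).summable).trans ?_
    rw [(hgs n).tsum_eq]
    exact le_of_eq (by ring)
  have hs5 : (2 : ℝ) < Real.sqrt 5 := by
    rw [Real.lt_sqrt (by norm_num)]; norm_num
  have hl : ((3 + Real.sqrt 5) / 2) ^ 2 = 3 * ((3 + Real.sqrt 5) / 2) - 1 := by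
    have := Real.sq_sqrt (show (0 : ℝ) ≤ 5 by norm_num)
    linear_combination this / 4
  have happ : ∀ μ : ℝ, μ < (3 + Real.sqrt 5) / 2 →
      ∀ᶠ n in Filter.atTop, |α - P n / x (n + 1)| < Real.exp (-μ * h n) := by
    intro μ hμ
    filter_upwards [eventually_mul_add_lt_of_recurrence hl (by linarith) h0 h1 hrec' ht hμ
      (Real.log 2)] with n hn
    rw [abs_of_pos (hdpos n)]
    refine (hdle n).trans_lt ?_
    rw [← hexp (n + 1), ← Real.exp_log (show (0 : ℝ) < 2 by norm_num), ← Real.exp_sub]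
    exact Real.exp_lt_exp.2 (by linarith)
  constructor
  · obtain ⟨s, hs⟩ := Filter.eventually_atTop.1 (happ (5 / 2) (by linarith))
    refine transcendental_of_approximations (P := fun n => P (n + s + 1))
      (Q := fun n => x (n + s + 1 + 1)) (fun n => ?_) ?_ (fun n => ?_) (fun n => ?_) (fun n => ?_)
    · have := hdouble (n + s)
      have := (hxy (n + s)).1
      change 2 ≤ x (n + s + 2)
      omega
    · exact ht.comp (Filter.tendsto_add_atTop_nat (s + 1))
    · exact (sub_pos.1 (hdpos (n + s + 1))).ne'
    · exact (hs (n + s + 1) (by omega)).le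
    · rw [abs_of_pos (hdpos (n + s + 1)), show n + 1 + s + 1 + 1 = n + s + 1 + 2 by ring]
      exact hdle (n + s + 1)
  · intro μ hμ
    obtain ⟨s, hs⟩ := Filter.eventually_atTop.1 (happ μ hμ)
    have hmono : StrictMono fun n => x (n + 1) := strictMono_nat_of_lt_succ fun n => by
      have := hdouble n
      have := (hxy n).1
      change x (n + 1) < x (n + 2)
      omega
    refine Set.infinite_of_injective_forall_mem (f := fun n => (P (n + s), x (n + s + 1))) ?_ ?_
    · intro i j hij
      have := hmono.injective (Prod.ext_iff.1 hij).2
      omega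
    · intro n
      refine ⟨(hxy _).1, abs_pos.2 (hdpos _).ne', ?_⟩
      have := hs (n + s) (by omega)
      rw [Real.rpow_def_of_pos (hxpos _), one_div, ← Real.exp_neg]
      convert this using 2
      simp only [hh]
      ring
end
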